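/- Let n >= 2, let q be a prime power, and let -1 <= i <= n-3. Let pi be an n-dimensional projective subspace of PG(2n+1,q^2) such that pi_i := pi intersect pi^sigma has projective dimension i. Let P be a point of H(2n+1,q^2) lying neither on pi nor on pi^sigma, lying on the projective span of pi and pi^sigma, and such that P does not lie on any projective line all of whose points lie on H(2n+1,q^2) that contains both a point on pi but not on pi_i and a point on pi^sigma but not on pi_i. Then the number of generators mu of H(2n+1,q^2) through P such that exactly one point of mu lies on pi but not on pi_i, and exactly one point of mu lies on pi^sigma but not on pi_i, equals N(n-1,i) * q^{4i+4} * (mu_{n-i-2}(q^2))^2. -/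

import Mathlib

open scoped BigOperators

namespace HermCode

/-- The Hermitian sesquilinear form `h(x,y) = ∑ᵢ xᵢ * yᵢ^q` on `F^m`. -/
def herm (q : ℕ) {F : Type} [Field F] {m : ℕ} (x y : Fin m → F) : F :=
  ∑ i, x i * (y i) ^ q

/-- For a fixed vector `x`, the linear map `y ↦ h(y,x)`. -/
def hermL (q : ℕ) {F : Type} [Field F] {m : ℕ} (x : Fin m → F) :
    (Fin m → F) →ₗ[F] F where
  toFun y := herm q y x
  map_add' a b := by
    simp [herm, add_mul, Finset.sum_add_distrib]
  map_smul' c a := by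
    simp [herm, Finset.mul_sum, mul_assoc]

/-- The image `W^σ` of a subspace `W` under the Hermitian polarity `σ`:
the subspace of all vectors orthogonal to every vector of `W`
with respect to the Hermitian form. -/
def polar (q : ℕ) {F : Type} [Field F] {m : ℕ} (W : Submodule F (Fin m → F)) :
    Submodule F (Fin m → F) :=
  ⨅ x : W, LinearMap.ker (hermL q (x : Fin m → F))

/-- A subspace all of whose points lie on the Hermitian variety. -/
def TotallyIsotropic (q : ℕ) {F : Type} [Field F] {m : ℕ}
    (W : Submodule F (Fin m → F)) : Prop :=
  ∀ x ∈ W, herm q x x = 0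

/-- A point of the Hermitian variety: a projective point (1-dimensional subspace)
spanned by an isotropic vector. -/
def IsHermPoint (q : ℕ) {F : Type} [Field F] {m : ℕ}
    (P : Submodule F (Fin m → F)) : Prop :=
  Module.finrank F P = 1 ∧ TotallyIsotropic q P

/-- A generator of `H(2n+1,q²)`: an `n`-dimensional projective subspace all of
whose points lie on the Hermitian variety. -/
def IsGenerator (q n : ℕ) {F : Type} [Field F]
    (W : Submodule F (Fin (2*n+2) → F)) : Prop :=
  Module.finrank F W = n + 1 ∧ TotallyIsotropic q W

/-- A code word of the dual code `C_n(H(2n+1,q²))^⊥`: a function from points to `F_p`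
(vanishing off the Hermitian variety) summing to zero over every generator. -/
def IsCodeword (p q n : ℕ) {F : Type} [Field F]
    (c : Submodule F (Fin (2*n+2) → F) → ZMod p) : Prop :=
  (∀ P, ¬ IsHermPoint q P → c P = 0) ∧
  ∀ μ, IsGenerator q n μ → (∑ᶠ P ∈ {P | IsHermPoint q P ∧ P ≤ μ}, c P) = 0

/-- The (Hamming) weight of a code word. -/
noncomputable def wt {p : ℕ} {α : Type*} (c : α → ZMod p) : ℕ :=
  Nat.card {x : α // c x ≠ 0}

open scoped Classical in
/-- The incidence vector `v_π` of `π ∩ H`. -/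
noncomputable def vsub (p q : ℕ) {F : Type} [Field F] {m : ℕ}
    (π : Submodule F (Fin m → F)) : Submodule F (Fin m → F) → ZMod p :=
  fun P => if IsHermPoint q P ∧ P ≤ π then 1 else 0

/-- `θ_m(q)`, the number of points of `PG(m,q)`. -/
noncomputable def theta (q : ℕ) (m : ℤ) : ℚ :=
  ((q:ℚ)^(m+1) - 1) / ((q:ℚ) - 1)

/-- `μ_m(q²)`, the number of points of `H(m,q²)` (with `μ_{-1} = 0`). -/
noncomputable def muH (q : ℕ) (m : ℤ) : ℚ :=
  (((q:ℚ)^(m+1) - (-1:ℚ)^(m+1)) * ((q:ℚ)^m - (-1:ℚ)^m)) / ((q:ℚ)^2 - 1)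

/-- The number `N(n,i)`. -/
noncomputable def NN (q n : ℕ) (i : ℤ) : ℚ :=
  (q:ℚ)^(((n:ℤ)-1)^2 - ((((n:ℤ)-i-1).toNat.choose 2 : ℕ) : ℤ)) *
    ∏ j ∈ Finset.range ((n:ℤ)-i-2).toNat, ((q:ℚ)^(j+1) - (-1:ℚ)^(j+1))

open scoped Classical in
/-- The quantity `Σ_{n,i}`. -/
noncomputable def SigmaNI (q n : ℕ) (i : ℤ) : ℚ :=
  if Odd ((n:ℤ) - i) then
    2*(q:ℚ)^(2*i+2) * muH q ((n:ℤ)-i-1)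
      + 4 * muH q ((n:ℤ)-i-2) * ((q:ℚ)^((n:ℤ)-i-1) - 1)
          / ((q:ℚ)^((n:ℤ)-3*i-5) * ((q:ℚ)^2 - 1))
  else
    2*(q:ℚ)^(2*i+2) * (muH q ((n:ℤ)-i-1)
      + 2*((q:ℚ)^(4:ℤ) * muH q ((n:ℤ)-i-3) + (q:ℚ)^2 - 1)/((q:ℚ)^2 - 1))

/-- `P` lies on a projective line entirely contained in the Hermitian variety that
meets both `π \ (π ⊓ π^σ)` and `π^σ \ (π ⊓ π^σ)`. -/
def OnGoodLine (q : ℕ) {F : Type} [Field F] {m : ℕ}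
    (π P : Submodule F (Fin m → F)) : Prop :=
  ∃ A B : Submodule F (Fin m → F),
    Module.finrank F A = 1 ∧ A ≤ π ∧ ¬ A ≤ π ⊓ polar q π ∧
    Module.finrank F B = 1 ∧ B ≤ polar q π ∧ ¬ B ≤ π ⊓ polar q π ∧
    P ≤ A ⊔ B ∧ TotallyIsotropic q (A ⊔ B)

end HermCode
namespace HermCode

/-- Basic facts about the field with `q^2` elements. -/
structure FC (q : ℕ) (F : Type) [Field F] [Fintype F] : Prop where
  two : 2 ≤ q
  card : Fintype.card F = q ^ 2
  add : ∀ a b : F, (a + b) ^ q = a ^ q + b ^ q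
  pp : ∀ a : F, (a ^ q) ^ q = a

theorem FC.mk' {q p hh : ℕ} (hp : p.Prime) (hh1 : 1 ≤ hh)
    (hq : q = p ^ hh)
    (F : Type) [Field F] [Fintype F] (hF : Fintype.card F = q ^ 2) : FC q F := by
  have : Fact p.Prime := ⟨hp⟩
  have : CharP F p := by
    apply charP_of_card_eq_prime_pow (f := hh * 2)
    rw [hF, hq, pow_mul]
  refine ⟨?_, hF, ?_, ?_⟩
  · rw [hq]
    calc 2 ≤ p := hp.two_le
      _ = p ^ 1 := (pow_one p).symm
      _ ≤ p ^ hh := Nat.pow_le_pow_right hp.pos hh1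
  · intro a b
    rw [hq]; exact add_pow_char_pow a b p hh
  · intro a
    rw [← pow_mul, ← pow_two, ← hF]; exact FiniteField.pow_card a

section
variable {q : ℕ} {F : Type} [Field F] [Fintype F]

theorem FC.q0 (H : FC q F) : q ≠ 0 := by have := H.two; omega

theorem FC.neg (H : FC q F) (a : F) : (-a) ^ q = - a ^ q := by
  have := H.add a (-a)
  rw [add_neg_cancel, zero_pow H.q0] at this
  exact (neg_eq_of_add_eq_zero_right this.symm).symm

theorem FC.sub (H : FC q F) (a b : F) : (a - b) ^ q = a ^ q - b ^ q := by
  rw [sub_eq_add_neg, H.add, H.neg, ← sub_eq_add_neg]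

theorem FC.sum (H : FC q F) {ι : Type*} (s : Finset ι) (f : ι → F) : (∑ i ∈ s, f i) ^ q = ∑ i ∈ s, f i ^ q := by
  classical
  induction s using Finset.induction_on with
  | empty => simp [H.q0]
  | insert a s ha ih => rw [Finset.sum_insert ha, Finset.sum_insert ha, H.add, ih]

theorem FC.pow_eq_zero (H : FC q F) {a : F} : a ^ q = 0 ↔ a = 0 := by
  simp [H.q0]
end

section
variable {q : ℕ} {F : Type} [Field F] [Fintype F]

open Classical in
theorem card_roots_le {R : Type} [CommRing R] [IsDomain R] [Fintype R] (P : Polynomial R) (n : ℕ) (hP : P ≠ 0) (hn : P.natDegree ≤ n)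
    (s : Finset R) (hs : ∀ x ∈ s, P.eval x = 0) : s.card ≤ n := by
  have : s ⊆ P.roots.toFinset := by
    intro x hx
    simp [hP, Polynomial.IsRoot, hs x hx]
  calc s.card ≤ P.roots.toFinset.card := Finset.card_le_card this
    _ ≤ P.roots.card := Multiset.toFinset_card_le _
    _ ≤ P.natDegree := P.card_roots'
    _ ≤ n := hn

/-- if all fibres are bounded by `b`, at most `a` targets and `|s| = a*b`, all fibers are `b`. -/
theorem fib_eq {α β : Type*} [DecidableEq β] (s : Finset α) (t : Finset β) (f : α → β) (a b : ℕ)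
    (hf : ∀ x ∈ s, f x ∈ t) (ht : t.card ≤ a) (hb : ∀ y ∈ t, (s.filter (fun x => f x = y)).card ≤ b)
    (hs : s.card = a * b) : ∀ y ∈ t, (s.filter (fun x => f x = y)).card = b := by
  have h1 := Finset.card_eq_sum_card_fiberwise (f := f) (s := s) (t := t) hf
  have h2 : ∑ y ∈ t, (s.filter (fun x => f x = y)).card ≤ ∑ y ∈ t, b := Finset.sum_le_sum hb
  have h3 : ∑ y ∈ t, b = t.card * b := by simp
  have h4 : t.card * b ≤ a * b := Nat.mul_le_mul_right _ ht
  have h5 : ∑ y ∈ t, (s.filter (fun x => f x = y)).card = ∑ y ∈ t, b := by omega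
  exact (Finset.sum_eq_sum_iff_of_le hb).1 h5

open Classical in
theorem trace_fiber (H : FC q F) (a : F) (ha : a ^ q = a) :
    (Finset.univ.filter (fun t : F => t + t ^ q = a)).card = q := by
  have h2 := H.two
  refine fib_eq (Finset.univ) (Finset.univ.filter (fun a : F => a ^ q = a)) (fun t : F => t + t ^ q) q q
    ?_ ?_ ?_ ?_ a ?_
  · intro x _
    simp only [Finset.mem_filter, Finset.mem_univ, true_and]
    rw [H.add, H.pp, add_comm]
  · refine card_roots_le (Polynomial.X ^ q - Polynomial.X : Polynomial F) q ?_ ?_ _ ?_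
    · exact FiniteField.X_pow_card_sub_X_ne_zero F (by omega)
    · exact (FiniteField.X_pow_card_sub_X_natDegree_eq F (by omega)).le
    · intro x hx; simp at hx; simp [hx]
  · intro y _
    have hd : (Polynomial.X ^ q + (Polynomial.X - Polynomial.C y) : Polynomial F).natDegree = q := by
      rw [Polynomial.natDegree_add_eq_left_of_natDegree_lt]
      · simp
      · simp; omega
    refine card_roots_le (Polynomial.X ^ q + (Polynomial.X - Polynomial.C y) : Polynomial F) q ?_ hd.le _ ?_
    · intro h0; rw [h0] at hd; simp at hd; omega
    · intro x hx; simp at hx; simp [← hx]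
  · rw [Finset.card_univ, H.card, pow_two]
  · simp [ha]

open Classical in
theorem norm_fiber (H : FC q F) (a : F) (ha : a ^ q = a) (ha0 : a ≠ 0) :
    (Finset.univ.filter (fun t : F => t * t ^ q = a)).card = q + 1 := by
  have h2 := H.two
  have := fib_eq (Finset.univ.filter (fun t : F => t ≠ 0))
    (Finset.univ.filter (fun a : F => a ^ q = a ∧ a ≠ 0)) (fun t : F => t * t ^ q) (q-1) (q+1)
    ?_ ?_ ?_ ?_ a ?_
  · rw [← this, Finset.filter_filter]
    congr 1
    ext t
    simp only [Finset.mem_filter, Finset.mem_univ, true_and]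
    refine ⟨fun h => ⟨?_, h⟩, fun h => h.2⟩
    rintro rfl
    simp at h
    exact ha0 h.symm
  · intro x hx
    simp only [Finset.mem_filter, Finset.mem_univ, true_and] at hx ⊢
    refine ⟨by rw [mul_pow, H.pp, mul_comm], mul_ne_zero hx (pow_ne_zero _ hx)⟩
  · have hd : (Polynomial.X ^ (q-1) - Polynomial.C 1 : Polynomial F).natDegree = q - 1 :=
      Polynomial.natDegree_X_pow_sub_C
    refine card_roots_le (Polynomial.X ^ (q-1) - Polynomial.C 1 : Polynomial F) (q-1) ?_ hd.le _ ?_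
    · intro h0; rw [h0] at hd; simp at hd; omega
    · intro x hx; simp at hx
      simp only [Polynomial.eval_sub, Polynomial.eval_pow, Polynomial.eval_X, Polynomial.eval_C]
      have : x ^ (q-1) * x = 1 * x := by
        rw [← pow_succ, Nat.sub_add_cancel (by omega), hx.1, one_mul]
      rw [mul_right_cancel₀ hx.2 this, sub_self]
  · intro y _
    have hd : (Polynomial.X ^ (q+1) - Polynomial.C y : Polynomial F).natDegree = q + 1 :=
      Polynomial.natDegree_X_pow_sub_C
    refine card_roots_le (Polynomial.X ^ (q+1) - Polynomial.C y : Polynomial F) (q+1) ?_ hd.le _ ?_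
    · intro h0; rw [h0] at hd; simp at hd
    · intro x hx; simp at hx; simp [← hx.2, pow_succ']
  · rw [Finset.filter_ne' Finset.univ (0:F), Finset.card_erase_of_mem (Finset.mem_univ _), Finset.card_univ, H.card]
    obtain ⟨k, rfl⟩ : ∃ k, q = k + 1 := ⟨q - 1, by omega⟩
    simp; ring_nf; omega
  · simp [ha, ha0]

section form
variable {k : ℕ}

theorem herm_add_left (x y z : (Fin k → F)) : herm q (x + y) z = herm q x z + herm q y z :=
  (hermL q z).map_add x y
theorem herm_smul_left (c : F) (x z : (Fin k → F)) : herm q (c • x) z = c * herm q x z :=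
  (hermL q z).map_smul c x
@[simp] theorem herm_zero_left (z : (Fin k → F)) : herm q 0 z = 0 :=
  (hermL q z).map_zero
theorem herm_sub_left (x y z : (Fin k → F)) : herm q (x - y) z = herm q x z - herm q y z :=
  (hermL q z).map_sub x y

theorem herm_symm (H : FC q F) (x y : (Fin k → F)) : herm q y x = (herm q x y) ^ q := by
  unfold herm
  rw [H.sum]
  refine Finset.sum_congr rfl fun i _ => ?_
  rw [mul_pow, H.pp, mul_comm]
theorem herm_add_right (H : FC q F) (x y z : (Fin k → F)) : herm q z (x + y) = herm q z x + herm q z y := by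
  rw [herm_symm H, herm_add_left, H.add, ← herm_symm H, ← herm_symm H]
theorem herm_sub_right (H : FC q F) (x y z : (Fin k → F)) : herm q z (x - y) = herm q z x - herm q z y := by
  rw [herm_symm H, herm_sub_left, H.sub, ← herm_symm H, ← herm_symm H]
theorem herm_smul_right (H : FC q F) (c : F) (x z : (Fin k → F)) : herm q z (c • x) = c ^ q * herm q z x := by
  rw [herm_symm H, herm_smul_left, mul_pow, ← herm_symm H]
theorem herm_zero_right (H : FC q F) (z : (Fin k → F)) : herm q z 0 = 0 := by
  rw [herm_symm H]; simp [H.q0]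
theorem herm_zero_comm (H : FC q F) {x y : (Fin k → F)} (h : herm q x y = 0) : herm q y x = 0 := by
  rw [herm_symm H, h, zero_pow H.q0]
theorem herm_self (H : FC q F) (x : (Fin k → F)) : (herm q x x) ^ q = herm q x x := (herm_symm H x x).symm

theorem mem_polar {W : Submodule F (Fin k → F)} {y : (Fin k → F)} : y ∈ polar q W ↔ ∀ x ∈ W, herm q y x = 0 := by
  simp only [polar, Submodule.mem_iInf, LinearMap.mem_ker, Subtype.forall]
  rfl

theorem polar_anti {W U : Submodule F (Fin k → F)} (h : W ≤ U) : polar q U ≤ polar q W := by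
  intro x hx
  rw [mem_polar] at *
  exact fun y hy => hx y (h hy)

theorem le_polar_comm (H : FC q F) {W U : Submodule F (Fin k → F)} (h : W ≤ polar q U) : U ≤ polar q W := by
  intro x hx
  rw [mem_polar]
  intro y hy
  exact herm_zero_comm H (mem_polar.1 (h hy) x hx)

theorem polar_sup (H : FC q F) (W U : Submodule F (Fin k → F)) : polar q (W ⊔ U) = polar q W ⊓ polar q U := by
  apply le_antisymm
  · exact le_inf (polar_anti le_sup_left) (polar_anti le_sup_right)
  · apply le_polar_comm H
    exact sup_le (le_polar_comm H inf_le_left) (le_polar_comm H inf_le_right)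

theorem mem_polar_span (H : FC q F) {S : Set (Fin k → F)} {y : (Fin k → F)} : y ∈ polar q (Submodule.span F S) ↔ ∀ x ∈ S, herm q y x = 0 := by
  constructor
  · intro h x hx; exact mem_polar.1 h x (Submodule.subset_span hx)
  · intro h
    have : Submodule.span F S ≤ polar q (Submodule.span F {y}) := by
      rw [Submodule.span_le]
      intro x hx
      rw [SetLike.mem_coe, mem_polar]
      intro z hz
      obtain ⟨c, rfl⟩ := Submodule.mem_span_singleton.1 hz
      rw [herm_smul_right H, herm_zero_comm H (h x hx), mul_zero]
    exact le_polar_comm H this (Submodule.mem_span_singleton_self y)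

theorem polar_top (H : FC q F) : polar q (⊤ : Submodule F (Fin k → F)) = ⊥ := by
  rw [eq_bot_iff]
  intro x hx
  rw [mem_polar] at hx
  rw [Submodule.mem_bot]
  ext i
  have := hx (Pi.single i 1) trivial
  simpa [herm, Pi.single_apply, H.q0, ite_pow] using this

open Module in
/-- dimension of the orthogonal complement. -/
theorem finrank_inf_polar (H : FC q F) (E S : Submodule F (Fin k → F)) (hS : S ⊓ polar q E = ⊥) :
    finrank F ↥(E ⊓ polar q S) + finrank F S = finrank F E := by
  let b := Module.finBasis F S
  let Φ : E →ₗ[F] (Fin (finrank F S) → F) :=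
    LinearMap.pi (fun j => (hermL q (b j : (Fin k → F))).comp E.subtype)
  have hΦ : ∀ e j, Φ e j = herm q (e : (Fin k → F)) (b j : (Fin k → F)) := fun e j => rfl
  have hker : LinearMap.ker Φ = (E ⊓ polar q S).comap E.subtype := by
    ext e
    simp only [LinearMap.mem_ker, Submodule.mem_comap, Submodule.subtype_apply, Submodule.mem_inf, SetLike.coe_mem, true_and]
    constructor
    · intro h
      rw [mem_polar]
      intro x hx
      have h2 : (x : (Fin k → F)) = ∑ j, b.repr ⟨x, hx⟩ j • (b j : (Fin k → F)) := by
        have := congrArg Subtype.val (b.sum_repr ⟨x, hx⟩)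
        rw [Submodule.coe_sum] at this
        exact this.symm
      rw [herm_symm H, h2]
      have h3 : ∀ j, herm q (b j : (Fin k → F)) (e : (Fin k → F)) = 0 := fun j => herm_zero_comm H (by rw [← hΦ, h]; rfl)
      have : herm q (∑ j, b.repr ⟨x, hx⟩ j • (b j : (Fin k → F))) (e:(Fin k → F)) = hermL q (e:(Fin k → F)) (∑ j, b.repr ⟨x, hx⟩ j • (b j : (Fin k → F))) := rfl
      rw [this, map_sum]
      have : ∀ j, hermL q (e:(Fin k → F)) (b.repr ⟨x, hx⟩ j • (b j : (Fin k → F))) = 0 := by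
        intro j
        rw [map_smul]
        change _ • herm q (b j : (Fin k → F)) (e : (Fin k → F)) = 0
        rw [h3]; simp
      simp [this, H.q0]
    · intro h
      ext j
      rw [hΦ]
      exact mem_polar.1 h _ (b j).2
  have hrange : LinearMap.range Φ = ⊤ := by
    by_contra hne
    obtain ⟨f, hf0, hf⟩ := Submodule.exists_le_ker_of_lt_top _ (lt_top_iff_ne_top.2 hne)
    apply hf0
    have hfx : ∀ x, f x = ∑ j, x j * f (Pi.single j 1) := by
      intro x
      conv_lhs => rw [pi_eq_sum_univ' x]
      rw [map_sum]
      refine Finset.sum_congr rfl fun j _ => ?_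
      rw [map_smul, smul_eq_mul]
    let s : S := ∑ j, (f (Pi.single j 1)) ^ q • b j
    have hs : ∀ e ∈ E, herm q e (s : (Fin k → F)) = 0 := by
      intro e he
      have : f (Φ ⟨e, he⟩) = 0 := hf (LinearMap.mem_range_self _ _)
      rw [hfx] at this
      rw [herm_symm H]
      have h1 : herm q (s : (Fin k → F)) e = ∑ j, (f (Pi.single j 1)) ^ q * herm q (b j : (Fin k → F)) e := by
        change hermL q e (s : (Fin k → F)) = _
        simp only [s, Submodule.coe_sum, map_sum, Submodule.coe_smul, map_smul, smul_eq_mul]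
        rfl
      rw [h1, H.sum, ← this]
      refine Finset.sum_congr rfl fun j _ => ?_
      rw [mul_pow, H.pp, ← herm_symm H, hΦ, mul_comm]
    have : (s : (Fin k → F)) ∈ S ⊓ polar q E := by
      refine ⟨s.2, ?_⟩
      rw [SetLike.mem_coe, mem_polar]
      intro e he
      exact herm_zero_comm H (hs e he)
    rw [hS, Submodule.mem_bot] at this
    have hs0 : s = 0 := Subtype.ext this
    have hc := Fintype.linearIndependent_iff.1 b.linearIndependent _ hs0
    ext j
    simpa [H.q0] using hc j
  have := LinearMap.finrank_range_add_finrank_ker Φ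
  rw [hrange, finrank_top, hker, Module.finrank_fin_fun] at this
  have h4 : finrank F ↥((E ⊓ polar q S).comap E.subtype) = finrank F ↥(E ⊓ polar q S) :=
    (Submodule.comapSubtypeEquivOfLe inf_le_left).finrank_eq
  omega

end form
end
end HermCode
namespace HermCode
section
open Module
variable {q : ℕ} {F : Type} [Field F] [Fintype F] {k : ℕ}

theorem exists_nonisotropic (H : FC q F) (E : Submodule F (Fin k → F)) (hE : ¬ E ≤ polar q E) :
    ∃ e ∈ E, herm q e e ≠ 0 := by
  classical
  by_contra! hcon
  apply hE
  intro x hx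
  rw [mem_polar]
  intro y hy
  by_contra hxy
  have h1 : (Finset.univ.filter (fun t : F => t + t ^ q = 1)).card = q := trace_fiber H 1 (one_pow q)
  have h2 : (Finset.univ.filter (fun t : F => t + t ^ q = 1)).Nonempty := by
    rw [← Finset.card_pos, h1]; have := H.two; omega
  obtain ⟨t, ht⟩ := h2
  simp only [Finset.mem_filter, Finset.mem_univ, true_and] at ht
  have h3 := hcon (((t / herm q x y) • x) + y) (E.add_mem (E.smul_mem _ hx) hy)
  rw [herm_add_left, herm_add_right H, herm_add_right H, herm_smul_left, herm_smul_left,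
    herm_smul_right H, herm_smul_right H, hcon x hx, hcon y hy, herm_symm H x y, div_pow] at h3
  have h4 : herm q x y ^ q ≠ 0 := pow_ne_zero _ hxy
  field_simp at h3
  simp only [mul_zero, add_zero, zero_add] at h3
  have h5 : (herm q x y * herm q x y ^ q) * (t + t ^ q) = 0 := by
    linear_combination h3
  rw [ht, mul_one] at h5
  exact mul_ne_zero hxy h4 h5

theorem polar_span_singleton_mem (H : FC q F) {x y : Fin k → F} :
    y ∈ polar q (Submodule.span F {x}) ↔ herm q y x = 0 := by
  rw [mem_polar_span H]; simp

open Classical in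
theorem card_mem (H : FC q F) (E : Submodule F (Fin k → F)) :
    (Finset.univ.filter (fun x : Fin k → F => x ∈ E)).card = q ^ (2 * finrank F E) := by
  rw [← Fintype.card_subtype]
  have := Module.card_eq_pow_finrank (K := F) (V := E)
  rw [H.card, ← pow_mul] at this
  convert this

open Classical in
theorem norm_count (H : FC q F) (d : ℕ) : ∀ (E : Submodule F (Fin k → F)) (r : ℕ),
    finrank F ↥(E ⊓ polar q E) = r → r + d = finrank F E →
    ∀ c : F, c ^ q = c →
    (q : ℤ) * (Finset.univ.filter (fun x : Fin k → F => x ∈ E ∧ herm q x x = c)).card =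
      (q:ℤ) ^ (2 * r) * ((q:ℤ) ^ (2 * d) - (-1) ^ d * (q:ℤ) ^ d +
        if c = 0 then (-1) ^ d * (q:ℤ) ^ (d + 1) else 0) := by
  induction d with
  | zero =>
    intro E r hr hd c hc
    have hE : E ⊓ polar q E = E := Submodule.eq_of_le_of_finrank_eq inf_le_left (by omega)
    have hiso : ∀ x ∈ E, herm q x x = 0 := fun x hx => mem_polar.1 ((inf_eq_left.1 hE) hx) x hx
    by_cases hc0 : c = 0
    · subst hc0
      have : (Finset.univ.filter (fun x : Fin k → F => x ∈ E ∧ herm q x x = 0)) =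
          Finset.univ.filter (fun x : Fin k → F => x ∈ E) := by
        ext x; simp only [Finset.mem_filter, Finset.mem_univ, true_and]
        exact ⟨fun h => h.1, fun h => ⟨h, hiso x h⟩⟩
      rw [this, card_mem H, ← hd]
      simp; ring
    · have : (Finset.univ.filter (fun x : Fin k → F => x ∈ E ∧ herm q x x = c)) = ∅ := by
        ext x; simp only [Finset.mem_filter, Finset.mem_univ, true_and, Finset.notMem_empty, iff_false]
        rintro ⟨h1, h2⟩
        rw [hiso x h1] at h2; exact hc0 h2.symm
      rw [this]; simp [hc0]
  | succ d ih =>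
    intro E r hr hd c hc
    obtain ⟨e, heE, he⟩ := exists_nonisotropic H E (by
      intro hle
      rw [inf_eq_left.2 hle] at hr; omega)
    set b := herm q e e with hb
    have hbq : b ^ q = b := herm_self H e
    set E' := E ⊓ polar q (Submodule.span F {e}) with hE'
    have hmem : ∀ x, x ∈ E' ↔ x ∈ E ∧ herm q x e = 0 := by
      intro x; rw [hE', Submodule.mem_inf, polar_span_singleton_mem H]
    have hdec : ∀ x ∈ E, x - (herm q x e / b) • e ∈ E' := by
      intro x hx
      rw [hmem]
      refine ⟨E.sub_mem hx (E.smul_mem _ heE), ?_⟩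
      rw [herm_sub_left, herm_smul_left, ← hb]; field_simp; ring
    have hrad : E' ⊓ polar q E' = E ⊓ polar q E := by
      ext x
      simp only [Submodule.mem_inf, hmem]
      constructor
      · rintro ⟨⟨h1, h2⟩, h3⟩
        refine ⟨h1, ?_⟩
        rw [mem_polar] at h3 ⊢
        intro y hy
        have := h3 _ (hdec y hy)
        rwa [herm_sub_right H, herm_smul_right H, h2, mul_zero, sub_zero] at this
      · rintro ⟨h1, h2⟩
        exact ⟨⟨h1, mem_polar.1 h2 e heE⟩, polar_anti inf_le_left h2⟩
    have he0 : e ≠ 0 := by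
      rintro rfl; simp [hb] at he
    have hfr : finrank F E' + 1 = finrank F E := by
      have := finrank_inf_polar H E (Submodule.span F {e}) ?_
      · rwa [finrank_span_singleton he0] at this
      · rw [eq_bot_iff]
        rintro x ⟨hx1, hx2⟩
        obtain ⟨t, rfl⟩ := Submodule.mem_span_singleton.1 hx1
        have := mem_polar.1 hx2 e heE
        rw [herm_smul_left] at this
        rcases mul_eq_zero.1 this with h | h
        · simp [h]
        · exact absurd h he
    have ih' := ih E' r (by rw [hrad, hr]) (by omega)
    have hsum : (Finset.univ.filter (fun x : Fin k → F => x ∈ E ∧ herm q x x = c)).card =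
        ∑ t : F, (Finset.univ.filter (fun x : Fin k → F => x ∈ E' ∧ herm q x x = c - t * t ^ q * b)).card := by
      rw [Finset.card_eq_sum_card_fiberwise (f := fun x => herm q x e / b) (t := Finset.univ) (by simp)]
      refine Finset.sum_congr rfl fun t _ => ?_
      refine Finset.card_bij' (fun x _ => x - t • e) (fun x _ => x + t • e) ?_ ?_ ?_ ?_
      · intro x hx
        simp only [Finset.mem_filter, Finset.mem_univ, true_and] at hx ⊢
        obtain ⟨⟨h1, h2⟩, h3⟩ := hx
        have h4 := hdec x h1
        rw [h3] at h4
        refine ⟨h4, ?_⟩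
        have h5 : herm q (x - t • e) e = 0 := ((hmem _).1 h4).2
        have h6 := herm_zero_comm H h5
        have : x = (x - t • e) + t • e := by simp
        rw [this, herm_add_left, herm_add_right H, herm_add_right H, herm_smul_right H, herm_smul_right H,
          herm_smul_left, herm_smul_left, h5, h6, ← hb] at h2
        rw [← h2]; ring
      · intro x hx
        simp only [Finset.mem_filter, Finset.mem_univ, true_and] at hx ⊢
        obtain ⟨h1, h2⟩ := hx
        rw [hmem] at h1
        have h6 := herm_zero_comm H h1.2
        refine ⟨⟨E.add_mem h1.1 (E.smul_mem _ heE), ?_⟩, ?_⟩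
        · rw [herm_add_left, herm_add_right H, herm_add_right H, herm_smul_right H, herm_smul_right H,
            herm_smul_left, herm_smul_left, h1.2, h6, ← hb, h2]; ring
        · rw [herm_add_left, herm_smul_left, h1.2, ← hb]; field_simp; ring
      · intro x _; simp
      · intro x _; simp
    rw [hsum]
    push_cast
    rw [Finset.mul_sum]
    have hq : ∀ t : F, (c - t * t ^ q * b) ^ q = c - t * t ^ q * b := by
      intro t
      rw [H.sub, hc, mul_pow, mul_pow, H.pp, hbq]; ring
    rw [Finset.sum_congr rfl (fun t _ => ih' _ (hq t)), ← Finset.mul_sum]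
    congr 1
    rw [Finset.sum_add_distrib, Finset.sum_const, Finset.card_univ, H.card, ← Finset.sum_filter, Finset.sum_const]
    have hf : (Finset.univ.filter (fun t : F => c - t * t ^ q * b = 0)) =
        Finset.univ.filter (fun t : F => t * t ^ q = c / b) := by
      ext t
      simp only [Finset.mem_filter, Finset.mem_univ, true_and]
      rw [sub_eq_zero, eq_div_iff he]
      exact eq_comm
    rw [hf]
    by_cases hc0 : c = 0
    · subst hc0
      have : (Finset.univ.filter (fun t : F => t * t ^ q = 0 / b)) = {0} := by
        ext t; simp [H.q0]
      rw [this]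
      simp; ring
    · rw [norm_fiber H (c / b) (by rw [div_pow, hc, hbq]) (div_ne_zero hc0 he)]
      simp [hc0]; ring

open Classical in
theorem rad_count (H : FC q F) (D : Finset (Fin k → F)) (u : Fin k → F) (hu : herm q u u = 0)
    (hD : ∀ w ∈ D, herm q u w = 1) (hD2 : ∀ w ∈ D, ∀ t : F, w + t • u ∈ D) :
    q * (D.filter (fun w => herm q w w = 0)).card = D.card := by
  have key := Finset.card_mul_eq_card_mul (s := D.filter (fun w => herm q w w = 0)) (t := D)
    (fun w w' => ∃ t : F, w' = w + t • u) (m := q ^ 2) (n := q) ?_ ?_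
  · have h2 := H.two
    have : q * (q * (D.filter (fun w => herm q w w = 0)).card) = q * D.card := by
      rw [mul_comm q D.card, ← key]; ring
    exact Nat.eq_of_mul_eq_mul_left (by omega) this
  · intro w hw
    simp only [Finset.mem_filter] at hw
    have hu0 : u ≠ 0 := by
      rintro rfl
      have := hD w hw.1
      simp at this
    have : D.bipartiteAbove (fun w w' => ∃ t : F, w' = w + t • u) w = Finset.univ.image (fun t : F => w + t • u) := by
      ext w'
      simp only [Finset.mem_bipartiteAbove, Finset.mem_image, Finset.mem_univ, true_and]
      constructor
      · rintro ⟨_, t, rfl⟩; exact ⟨t, rfl⟩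
      · rintro ⟨t, rfl⟩; exact ⟨hD2 w hw.1 t, t, rfl⟩
    rw [this, Finset.card_image_of_injective, Finset.card_univ, H.card]
    intro t t' h
    simpa using smul_left_injective F hu0 (add_left_cancel h)
  · intro w hw
    have hu0 : u ≠ 0 := by
      rintro rfl
      have := hD w hw
      simp at this
    have hw1 : herm q w u = 1 := by rw [herm_symm H, hD w hw, one_pow]
    have : (D.filter (fun w => herm q w w = 0)).bipartiteBelow (fun w w' => ∃ t : F, w' = w + t • u) w =
        (Finset.univ.filter (fun t : F => t + t ^ q = - herm q w w)).image (fun t : F => w + t • u) := by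
      ext w'
      simp only [Finset.mem_bipartiteBelow, Finset.mem_image, Finset.mem_univ, true_and, Finset.mem_filter]
      have hc : ∀ t : F, herm q (w + t • u) (w + t • u) = 0 ↔ t + t ^ q = - herm q w w := by
        intro t
        rw [herm_add_left, herm_add_right H, herm_add_right H, herm_smul_right H, herm_smul_right H,
          herm_smul_left, herm_smul_left, hu, hD w hw, hw1, eq_neg_iff_add_eq_zero]
        ring_nf
      constructor
      · rintro ⟨⟨h1, h2⟩, t, rfl⟩
        refine ⟨-t, ?_, by simp⟩
        rw [← hc]
        simpa using h2
      · rintro ⟨t, ht, rfl⟩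
        exact ⟨⟨hD2 w hw t, (hc t).2 ht⟩, -t, by simp⟩
    rw [this, Finset.card_image_of_injective, trace_fiber H]
    · rw [H.neg, herm_self H]
    intro t t' h
    simpa using smul_left_injective F hu0 (add_left_cancel h)

/-- `W` is a maximal totally isotropic subspace of `E`. -/
def Lag (q : ℕ) {F : Type} [Field F] {k : ℕ} (E W : Submodule F (Fin k → F)) : Prop :=
  W = E ⊓ polar q W

theorem Lag.le {E W : Submodule F (Fin k → F)} (h : Lag q E W) : W ≤ E := by
  rw [Lag] at h; rw [h]; exact inf_le_left
theorem Lag.le_polar {E W : Submodule F (Fin k → F)} (h : Lag q E W) : W ≤ polar q W := by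
  conv_lhs => rw [h]
  exact inf_le_right

theorem lag_card (H : FC q F) (E L M A : Submodule F (Fin k → F)) (hLE : L ≤ E) (hL : L ≤ polar q L)
    (hML : M ⊔ L = E ⊓ polar q L) (hML0 : M ⊓ L = ⊥) :
    Nat.card {W : Submodule F (Fin k → F) // Lag q E W ∧ L ≤ W ∧ W ⊓ A ≤ L} =
    Nat.card {W : Submodule F (Fin k → F) // Lag q M W ∧ W ⊓ (((A ⊓ polar q L) ⊔ L) ⊓ M) = ⊥} := by
  have hME : M ≤ E := (le_sup_left.trans hML.le).trans inf_le_left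
  have hMp : M ≤ polar q L := (le_sup_left.trans hML.le).trans inf_le_right
  have hsplit : ∀ X, L ≤ X → X ≤ M ⊔ L → (X ⊓ M) ⊔ L = X := by
    intro X h1 h2
    rw [inf_sup_assoc_of_le _ h1, inf_eq_left.2 h2]
  have hWM : ∀ W, Lag q E W → L ≤ W → W ≤ M ⊔ L := by
    intro W hW hLW
    rw [hML]
    exact le_inf hW.le (hW.le_polar.trans (polar_anti hLW))
  refine Nat.card_congr ⟨fun W => ⟨W.1 ⊓ M, ?_, ?_⟩, fun W => ⟨W.1 ⊔ L, ?_, ?_, ?_⟩, ?_, ?_⟩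
  · obtain ⟨W, hW, hLW, hA⟩ := W
    have hs := hsplit W hLW (hWM W hW hLW)
    apply le_antisymm
    · exact le_inf inf_le_right (inf_le_left.trans (hW.le_polar.trans (polar_anti inf_le_left)))
    · refine le_inf ?_ inf_le_left
      refine le_trans ?_ (le_of_eq hW.symm)
      refine le_inf (inf_le_left.trans hME) ?_
      conv_rhs => rw [← hs, polar_sup H]
      exact le_inf inf_le_right (inf_le_left.trans hMp)
  · obtain ⟨W, hW, hLW, hA⟩ := W
    have hWp : W ≤ polar q L := hW.le_polar.trans (polar_anti hLW)
    have h1 : W ⊓ ((A ⊓ polar q L) ⊔ L) ≤ L := by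
      rw [sup_comm, inf_comm, sup_inf_assoc_of_le _ hLW]
      refine sup_le le_rfl (le_trans ?_ hA)
      exact le_inf inf_le_right (inf_le_left.trans inf_le_left)
    rw [eq_bot_iff, ← hML0]
    exact le_inf (inf_le_left.trans inf_le_right) ((inf_le_inf inf_le_left inf_le_left).trans h1)
  · obtain ⟨W, hW, hA⟩ := W
    have hWM' := hW.le
    apply le_antisymm
    · refine sup_le (le_inf (hWM'.trans hME) ?_) (le_inf hLE ?_)
      · rw [polar_sup H]; exact le_inf hW.le_polar (hWM'.trans hMp)
      · rw [polar_sup H]; exact le_inf (le_polar_comm H (hWM'.trans hMp)) hL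
    · intro x hx
      rw [polar_sup H] at hx
      obtain ⟨hxE, hxW, hxL⟩ := hx
      have : x ∈ M ⊔ L := by rw [hML]; exact ⟨hxE, hxL⟩
      obtain ⟨m, hm, l, hl, rfl⟩ := Submodule.mem_sup.1 this
      refine Submodule.add_mem _ (Submodule.mem_sup_left ?_) (Submodule.mem_sup_right hl)
      refine (le_of_eq hW.symm) ?_
      refine ⟨hm, ?_⟩
      have hlW : l ∈ polar q W := (le_polar_comm H (hWM'.trans hMp)) hl
      have := (polar q W).sub_mem hxW hlW
      simpa using this
  · exact le_sup_right
  · obtain ⟨W, hW, hA⟩ := W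
    have hWM' := hW.le
    have hWp : W ⊔ L ≤ polar q L := sup_le (hWM'.trans hMp) hL
    set X := (W ⊔ L) ⊓ A with hX
    have h1 : X ⊔ L ≤ M ⊔ L := sup_le (inf_le_left.trans (sup_le_sup_right hWM' L)) le_sup_right
    have h2 := hsplit (X ⊔ L) le_sup_right h1
    have h3 : (X ⊔ L) ⊓ M ≤ ⊥ := by
      rw [← hA]
      refine le_inf ?_ (inf_le_inf_right M (sup_le_sup_right (le_inf inf_le_right (inf_le_left.trans hWp)) L))
      have : X ⊔ L ≤ W ⊔ L := sup_le inf_le_left le_sup_right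
      refine (inf_le_inf_right M this).trans ?_
      rw [sup_inf_assoc_of_le _ hWM', inf_comm L M, hML0, sup_bot_eq]
    rw [le_bot_iff.1 h3, bot_sup_eq] at h2
    calc X ≤ X ⊔ L := le_sup_left
      _ = L := h2.symm
  · rintro ⟨W, hW, hLW, hA⟩
    exact Subtype.ext (hsplit W hLW (hWM W hW hLW))
  · rintro ⟨W, hW, hA⟩
    apply Subtype.ext
    change (W ⊔ L) ⊓ M = W
    rw [sup_inf_assoc_of_le _ hW.le, inf_comm L M, hML0, sup_bot_eq]

theorem polar_polar_rel (H : FC q F) (E L : Submodule F (Fin k → F)) (hE : E ⊓ polar q E = ⊥) (hLE : L ≤ E) :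
    E ⊓ polar q (E ⊓ polar q L) = L := by
  symm
  apply Submodule.eq_of_le_of_finrank_eq
  · exact le_inf hLE (le_polar_comm H inf_le_right)
  · have h1 := finrank_inf_polar H E L (eq_bot_iff.2 ((inf_le_inf_right _ hLE).trans hE.le))
    have h2 := finrank_inf_polar H E (E ⊓ polar q L)
      (eq_bot_iff.2 ((inf_le_inf_right _ inf_le_left).trans hE.le))
    omega

theorem polar_polar (H : FC q F) (L : Submodule F (Fin k → F)) : polar q (polar q L) = L := by
  have := polar_polar_rel H ⊤ L (by rw [polar_top H]; simp) le_top
  simpa using this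

theorem M_nondeg (H : FC q F) (E L M : Submodule F (Fin k → F)) (hE : E ⊓ polar q E = ⊥)
    (hLE : L ≤ E)
    (hML : M ⊔ L = E ⊓ polar q L) (hML0 : M ⊓ L = ⊥) :
    M ⊓ polar q M = ⊥ := by
  have hME : M ≤ E := (le_sup_left.trans hML.le).trans inf_le_left
  have hMp : M ≤ polar q L := (le_sup_left.trans hML.le).trans inf_le_right
  rw [eq_bot_iff, ← hML0]
  refine le_inf inf_le_left ?_
  conv_rhs => rw [← polar_polar_rel H E L hE hLE, ← hML, polar_sup H]
  exact le_inf (inf_le_left.trans hME) (le_inf inf_le_right (inf_le_left.trans hMp))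

theorem M_finrank (H : FC q F) (E L M : Submodule F (Fin k → F)) (hE : E ⊓ polar q E = ⊥)
    (hLE : L ≤ E)
    (hML : M ⊔ L = E ⊓ polar q L) (hML0 : M ⊓ L = ⊥) :
    finrank F M + 2 * finrank F L = finrank F E := by
  have h1 := finrank_inf_polar H E L (eq_bot_iff.2 ((inf_le_inf_right _ hLE).trans hE.le))
  have h2 := Submodule.finrank_sup_add_finrank_inf_eq M L
  rw [hML0, hML, finrank_bot] at h2
  omega

end
end HermCode
namespace HermCode
section
open Module
variable {q : ℕ} {F : Type} [Field F] [Fintype F] {k : ℕ}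

theorem nondeg_sub {E S : Submodule F (Fin k → F)} (hE : E ⊓ polar q E = ⊥) (hS : S ≤ E) :
    S ⊓ polar q E = ⊥ :=
  eq_bot_iff.2 ((inf_le_inf_right _ hS).trans hE.le)

theorem lag_finrank (H : FC q F) {E W : Submodule F (Fin k → F)} (hE : E ⊓ polar q E = ⊥) (hW : Lag q E W) :
    2 * finrank F W = finrank F E := by
  have h := finrank_inf_polar H E W (nondeg_sub hE hW.le)
  rw [← hW] at h
  omega

theorem lag_inf_polar (H : FC q F) {E W U : Submodule F (Fin k → F)} (hE : E ⊓ polar q E = ⊥) (hW : Lag q E W)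
    (hU : U ≤ E) :
    finrank F ↥(W ⊓ polar q U) + finrank F ↥(W ⊔ U) = finrank F E := by
  have h := finrank_inf_polar H E (W ⊔ U) (nondeg_sub hE (sup_le hW.le hU))
  have : E ⊓ polar q (W ⊔ U) = W ⊓ polar q U := by
    rw [polar_sup H, ← inf_assoc, ← hW]
  rw [← this]; exact h

open Classical in
/-- The admissible dual vectors. -/
noncomputable def Wset (q : ℕ) {F : Type} [Field F] [Fintype F] {k : ℕ}
    (E U' : Submodule F (Fin k → F)) (u : Fin k → F) : Finset (Fin k → F) :=
  Finset.univ.filter (fun w => w ∈ E ∧ w ∈ polar q U' ∧ herm q u w = 1 ∧ herm q w w = 0)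

theorem mem_polar_sup_span (H : FC q F) {U' : Submodule F (Fin k → F)} {u w : Fin k → F} :
    w ∈ polar q (U' ⊔ Submodule.span F {u}) ↔ w ∈ polar q U' ∧ herm q w u = 0 := by
  rw [polar_sup H, Submodule.mem_inf, polar_span_singleton_mem H]

theorem mem_polar_pair (H : FC q F) {u w x : Fin k → F} :
    x ∈ polar q (Submodule.span F {u, w}) ↔ herm q x u = 0 ∧ herm q x w = 0 := by
  rw [mem_polar_span H]; simp

theorem lag_step (H : FC q F) (m T : ℕ) (E U U' : Submodule F (Fin k → F)) (u : Fin k → F)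
    (hE : E ⊓ polar q E = ⊥) (hfE : finrank F E = 2 * (m + 1)) (hUE : U ≤ E)
    (hfU : finrank F U = m + 1) (hu : u ∈ U) (hU' : U' ⊔ Submodule.span F {u} = U)
    (hfU' : finrank F U' = m) (huU' : ∀ x ∈ U', herm q x u = 0)
    (hwU : ∀ w ∈ Wset q E U' u, w ∉ U)
    (hT : ∀ w ∈ Wset q E U' u, Nat.card {W : Submodule F (Fin k → F) //
      Lag q (E ⊓ polar q (Submodule.span F {u, w})) W ∧ W ⊓ U' = ⊥} = T) :
    Nat.card {W : Submodule F (Fin k → F) // Lag q E W ∧ W ⊓ U = ⊥} = (Wset q E U' u).card * T := by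
  classical
  haveI : Fintype (Submodule F (Fin k → F)) := Fintype.ofFinite _
  have hU'U : U' ≤ U := hU' ▸ le_sup_left
  rw [Nat.card_eq_fintype_card, Fintype.card_subtype]
  have key := Finset.card_mul_eq_card_mul
    (s := Finset.univ.filter (fun W : Submodule F (Fin k → F) => Lag q E W ∧ W ⊓ U = ⊥))
    (t := Wset q E U' u) (fun W w => w ∈ W) (m := 1) (n := T) ?_ ?_
  · rw [← key, mul_one]
  · intro W hW
    simp only [Finset.mem_filter, Finset.mem_univ, true_and] at hW
    obtain ⟨hW, hWU⟩ := hW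
    have hfW := lag_finrank H hE hW
    have h1 := lag_inf_polar H hE hW hUE
    have h2 := lag_inf_polar H hE hW (hU'U.trans hUE)
    have h3 := Submodule.finrank_sup_add_finrank_inf_eq W U
    have h4 := Submodule.finrank_sup_add_finrank_inf_eq W U'
    rw [hWU, finrank_bot] at h3
    have h5 : W ⊓ polar q U = ⊥ := by
      rw [← Submodule.finrank_eq_zero (R := F)]; omega
    have h6 : W ⊓ polar q U' ≠ ⊥ := by
      rw [Ne, ← Submodule.finrank_eq_zero (R := F)]; omega
    obtain ⟨w, hw, hw0⟩ := (Submodule.ne_bot_iff _).1 h6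
    have hwu : herm q u w ≠ 0 := by
      intro h0
      apply hw0
      have : w ∈ W ⊓ polar q U := by
        refine ⟨hw.1, ?_⟩
        rw [← hU']
        exact (mem_polar_sup_span H).2 ⟨hw.2, herm_zero_comm H h0⟩
      rwa [h5, Submodule.mem_bot] at this
    rw [Finset.card_eq_one]
    refine ⟨(herm q w u)⁻¹ • w, ?_⟩
    ext x
    simp only [Finset.mem_bipartiteAbove, Finset.mem_singleton, Wset, Finset.mem_filter, Finset.mem_univ, true_and]
    have hz1 : herm q u ((herm q w u)⁻¹ • w) = 1 := by
      rw [herm_smul_right H, inv_pow, ← herm_symm H, inv_mul_cancel₀ hwu]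
    have hzW : (herm q w u)⁻¹ • w ∈ W := W.smul_mem _ hw.1
    have hzU : (herm q w u)⁻¹ • w ∈ polar q U' := Submodule.smul_mem _ _ hw.2
    constructor
    · rintro ⟨⟨hx1, hx2, hx3, hx4⟩, hx5⟩
      rw [← sub_eq_zero]
      have : x - (herm q w u)⁻¹ • w ∈ W ⊓ polar q U := by
        refine ⟨W.sub_mem hx5 hzW, ?_⟩
        rw [← hU']
        refine (mem_polar_sup_span H).2 ⟨Submodule.sub_mem _ hx2 hzU, herm_zero_comm H ?_⟩
        rw [herm_sub_right H, hx3, hz1, sub_self]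
      rwa [h5, Submodule.mem_bot] at this
    · rintro rfl
      exact ⟨⟨hW.le hzW, hzU, hz1, mem_polar.1 (hW.le_polar hzW) _ hzW⟩, hzW⟩
  · intro w hw
    rw [← hT w hw]
    have hwU0 := hwU w hw
    simp only [Wset, Finset.mem_filter, Finset.mem_univ, true_and] at hw
    obtain ⟨hw1, hw2, hw3, hw4⟩ := hw
    have hw3' : herm q w u = 1 := by rw [herm_symm H, hw3, one_pow]
    have hw0 : w ≠ 0 := by rintro rfl; simp at hw3'
    set L := Submodule.span F {w} with hL
    set M := E ⊓ polar q (Submodule.span F {u, w}) with hM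
    have hLU : L ⊓ U = ⊥ := by
      rw [eq_bot_iff]
      rintro x ⟨hx1, hx2⟩
      obtain ⟨t, rfl⟩ := Submodule.mem_span_singleton.1 hx1
      by_cases ht : t = 0
      · simp [ht]
      · exact absurd ((U.smul_mem_iff ht).1 hx2) hwU0
    have hLE : L ≤ E := by
      rw [hL, Submodule.span_singleton_le_iff_mem]; exact hw1
    have hLp : L ≤ polar q L := by
      rw [hL, Submodule.span_singleton_le_iff_mem, polar_span_singleton_mem H]; exact hw4
    have hML : M ⊔ L = E ⊓ polar q L := by
      apply le_antisymm
      · refine sup_le (le_inf inf_le_left (inf_le_right.trans (polar_anti ?_))) (le_inf hLE hLp)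
        exact Submodule.span_mono (by simp)
      · rintro x ⟨hx1, hx2⟩
        have hx3 : herm q x w = 0 := (polar_span_singleton_mem H).1 hx2
        have : x = (x - herm q x u • w) + herm q x u • w := by simp
        rw [this]
        refine Submodule.add_mem_sup ⟨E.sub_mem hx1 (E.smul_mem _ hw1), ?_⟩ (Submodule.smul_mem _ _ (Submodule.mem_span_singleton_self w))
        refine (mem_polar_pair H).2 ⟨?_, ?_⟩
        · rw [herm_sub_left, herm_smul_left, hw3', mul_one, sub_self]
        · rw [herm_sub_left, herm_smul_left, hw4, mul_zero, sub_zero, hx3]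
    have hML0 : M ⊓ L = ⊥ := by
      rw [eq_bot_iff]
      rintro x ⟨hx1, hx2⟩
      obtain ⟨t, rfl⟩ := Submodule.mem_span_singleton.1 hx2
      have := ((mem_polar_pair H).1 hx1.2).1
      rw [herm_smul_left, hw3', mul_one] at this
      simp [this]
    have hU'M : U' ≤ M := by
      intro x hx
      exact ⟨hUE (hU'U hx), (mem_polar_pair H).2 ⟨huU' x hx, herm_zero_comm H (mem_polar.1 hw2 x hx)⟩⟩
    have hA : ((U ⊓ polar q L) ⊔ L) ⊓ M = U' := by
      have : U ⊓ polar q L = U' := by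
        apply le_antisymm
        · rintro x ⟨hx1, hx2⟩
          have hx3 : herm q x w = 0 := (polar_span_singleton_mem H).1 hx2
          have hx1' : x ∈ U := hx1
          rw [← hU'] at hx1'
          obtain ⟨y, hy, z, hz, rfl⟩ := Submodule.mem_sup.1 hx1'
          obtain ⟨t, rfl⟩ := Submodule.mem_span_singleton.1 hz
          rw [herm_add_left, herm_smul_left, hw3, herm_zero_comm H (mem_polar.1 hw2 y hy)] at hx3
          have : t = 0 := by simpa using hx3
          simpa [this] using hy
        · intro x hx
          exact ⟨hU'U hx, (polar_span_singleton_mem H).2 (herm_zero_comm H (mem_polar.1 hw2 x hx))⟩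
      rw [this, sup_inf_assoc_of_le _ hU'M, inf_comm L M, hML0, sup_bot_eq]
    have hcard := lag_card H E L M U hLE hLp hML hML0
    rw [hA] at hcard
    rw [← hcard, Nat.card_eq_fintype_card, Fintype.card_subtype]
    congr 1
    ext W
    simp only [Finset.mem_bipartiteBelow, Finset.mem_filter, Finset.mem_univ, true_and]
    have hLW : L ≤ W ↔ w ∈ W := by rw [hL, Submodule.span_singleton_le_iff_mem]
    rw [hLW]
    constructor
    · rintro ⟨⟨h1, h2⟩, h3⟩
      exact ⟨h1, h3, by rw [h2]; exact bot_le⟩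
    · rintro ⟨h1, h2, h3⟩
      refine ⟨⟨h1, ?_⟩, h2⟩
      rw [eq_bot_iff, ← hLU]
      exact le_inf h3 inf_le_right

theorem M_pair (H : FC q F) (m : ℕ) (E : Submodule F (Fin k → F)) (u w : Fin k → F)
    (hE : E ⊓ polar q E = ⊥) (hfE : finrank F E = 2 * (m + 1)) (hu : u ∈ E) (hw : w ∈ E)
    (huw : herm q u w = 1) (hww : herm q w w = 0) :
    (E ⊓ polar q (Submodule.span F {u, w})) ⊓ polar q (E ⊓ polar q (Submodule.span F {u, w})) = ⊥ ∧
    finrank F ↥(E ⊓ polar q (Submodule.span F {u, w})) = 2 * m := by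
  have hw3' : herm q w u = 1 := by rw [herm_symm H, huw, one_pow]
  have hw0 : w ≠ 0 := by rintro rfl; simp at hw3'
  set S := Submodule.span F {u, w} with hS
  have hSE : S ≤ E := by
    rw [hS, Submodule.span_le]; rintro x (rfl | rfl) <;> assumption
  have hSS : S ⊓ polar q S = ⊥ := by
    rw [eq_bot_iff]
    rintro x ⟨hx1, hx2⟩
    obtain ⟨a, b, rfl⟩ := Submodule.mem_span_pair.1 hx1
    obtain ⟨h1, h2⟩ := (mem_polar_pair H).1 hx2
    rw [herm_add_left, herm_smul_left, herm_smul_left, huw, hww] at h2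
    have ha : a = 0 := by simpa using h2
    rw [herm_add_left, herm_smul_left, herm_smul_left, hw3', ha] at h1
    have hb : b = 0 := by simpa using h1
    simp [ha, hb]
  have hfS : finrank F S = 2 := by
    have hli : LinearIndependent F ![u, w] := by
      rw [LinearIndependent.pair_iff]
      intro a b hab
      have h2 := congrArg (fun x => herm q x w) hab
      simp only [herm_add_left, herm_smul_left, huw, hww, herm_zero_left] at h2
      have ha : a = 0 := by simpa using h2
      have h1 := congrArg (fun x => herm q x u) hab
      simp only [herm_add_left, herm_smul_left, hw3', ha, herm_zero_left] at h1
      exact ⟨ha, by simpa using h1⟩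
    have := finrank_span_eq_card hli
    rw [Matrix.range_cons, Matrix.range_cons, Matrix.range_empty, Set.union_empty, Set.singleton_union] at this
    rw [hS, this]; rfl
  have hf := finrank_inf_polar H E S (nondeg_sub hE hSE)
  refine ⟨?_, by omega⟩
  rw [eq_bot_iff, ← hSS]
  conv_rhs => rw [← polar_polar_rel H E S hE hSE]
  refine le_inf (le_inf (inf_le_left.trans inf_le_left) inf_le_right) ?_
  rw [polar_polar_rel H E S hE hSE]
  exact inf_le_left.trans inf_le_right

open Classical in
theorem Wset_card_rad (H : FC q F) (m : ℕ) (E U U' : Submodule F (Fin k → F)) (u : Fin k → F)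
    (hE : E ⊓ polar q E = ⊥) (hfE : finrank F E = 2 * (m + 1)) (hUE : U ≤ E)
    (hfU : finrank F U = m + 1) (hu : u ∈ U) (hU' : U' ⊔ Submodule.span F {u} = U)
    (hfU' : finrank F U' = m) (hup : u ∈ polar q U) :
    (Wset q E U' u).card = q ^ (2 * m + 1) := by
  have hU'U : U' ≤ U := hU' ▸ le_sup_left
  have h1 := finrank_inf_polar H E U (nondeg_sub hE hUE)
  have h2 := finrank_inf_polar H E U' (nondeg_sub hE (hU'U.trans hUE))
  have hex : ∃ z ∈ E ⊓ polar q U', z ∉ E ⊓ polar q U := by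
    by_contra! hcon
    have := Submodule.finrank_mono (show E ⊓ polar q U' ≤ E ⊓ polar q U from hcon)
    omega
  obtain ⟨z, hz, hzn⟩ := hex
  have hzu : herm q z u ≠ 0 := by
    intro h0
    apply hzn
    refine ⟨hz.1, ?_⟩
    rw [← hU']
    exact (mem_polar_sup_span H).2 ⟨hz.2, h0⟩
  set y := (herm q z u)⁻¹ • z with hy
  have hyE : y ∈ E := E.smul_mem _ hz.1
  have hyU : y ∈ polar q U' := Submodule.smul_mem _ _ hz.2
  have hyu : herm q y u = 1 := by
    rw [hy, herm_smul_left, inv_mul_cancel₀ hzu]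
  have hyu' : herm q u y = 1 := by rw [herm_symm H, hyu, one_pow]
  set D : Finset (Fin k → F) := Finset.univ.filter (fun w => w ∈ E ∧ w ∈ polar q U' ∧ herm q u w = 1) with hD
  have hDc : D.card = q ^ (2 * (m + 1)) := by
    have : finrank F ↥(E ⊓ polar q U) = m + 1 := by omega
    rw [← this, ← card_mem H]
    refine Finset.card_bij' (fun w _ => w - y) (fun w _ => w + y) ?_ ?_ ?_ ?_
    · intro w hw
      simp only [hD, Finset.mem_filter, Finset.mem_univ, true_and] at hw ⊢
      refine ⟨E.sub_mem hw.1 hyE, ?_⟩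
      rw [← hU']
      refine (mem_polar_sup_span H).2 ⟨Submodule.sub_mem _ hw.2.1 hyU, herm_zero_comm H ?_⟩
      rw [herm_sub_right H, hw.2.2, hyu', sub_self]
    · intro w hw
      simp only [hD, Finset.mem_filter, Finset.mem_univ, true_and] at hw ⊢
      refine ⟨E.add_mem hw.1 hyE, Submodule.add_mem _ (polar_anti hU'U hw.2) hyU, ?_⟩
      rw [herm_add_right H, hyu', herm_zero_comm H (mem_polar.1 hw.2 u hu), zero_add]
    · intro w _; simp
    · intro w _; simp
  have huu : herm q u u = 0 := mem_polar.1 hup u hu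
  have := rad_count H D u huu (by intro w hw; simp only [hD, Finset.mem_filter] at hw; exact hw.2.2.2) (by
    intro w hw t
    simp only [hD, Finset.mem_filter, Finset.mem_univ, true_and] at hw ⊢
    refine ⟨E.add_mem hw.1 (E.smul_mem _ (hUE hu)), Submodule.add_mem _ hw.2.1 (Submodule.smul_mem _ _ (polar_anti hU'U hup)), ?_⟩
    rw [herm_add_right H, herm_smul_right H, huu, mul_zero, add_zero]; exact hw.2.2)
  have h3 : D.filter (fun w => herm q w w = 0) = Wset q E U' u := by
    ext w
    simp only [hD, Wset, Finset.mem_filter, Finset.mem_univ, true_and]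
    tauto
  rw [h3, hDc] at this
  have h2 := H.two
  refine Nat.eq_of_mul_eq_mul_left (show 0 < q by omega) (this.trans ?_)
  ring

open Classical in
theorem Wset_card_nondeg (H : FC q F) (m : ℕ) (E U U' : Submodule F (Fin k → F)) (u : Fin k → F)
    (hE : E ⊓ polar q E = ⊥) (hfE : finrank F E = 2 * (m + 1)) (hUE : U ≤ E)
    (hfU : finrank F U = m + 1) (hu : u ∈ U) (hU' : U' ⊔ Submodule.span F {u} = U)
    (huU' : ∀ x ∈ U', herm q x u = 0) (hUU : U ⊓ polar q U = ⊥)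
    (huu : herm q u u ≠ 0) :
    (q : ℤ) * (Wset q E U' u).card = (q:ℤ) ^ (2 * (m + 1)) - (-1) ^ (m + 1) * (q:ℤ) ^ (m + 1) := by
  have hU'U : U' ≤ U := hU' ▸ le_sup_left
  set b := herm q u u with hb
  have hbq : b ^ q = b := herm_self H u
  have h1 := finrank_inf_polar H E U (nondeg_sub hE hUE)
  have hG : (E ⊓ polar q U) ⊓ polar q (E ⊓ polar q U) = ⊥ := by
    rw [eq_bot_iff, ← hUU]
    conv_rhs => rw [← polar_polar_rel H E U hE hUE]
    refine le_inf (le_inf (inf_le_left.trans inf_le_left) inf_le_right) ?_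
    rw [polar_polar_rel H E U hE hUE]
    exact inf_le_left.trans inf_le_right
  have hc := norm_count H (m + 1) (E ⊓ polar q U) 0 (by rw [hG, finrank_bot]) (by omega) (-b⁻¹)
    (by rw [H.neg, inv_pow, hbq])
  rw [if_neg (by simpa using huu)] at hc
  simp only [mul_zero, pow_zero, one_mul, add_zero] at hc
  rw [← hc]
  congr 2
  have hyu : herm q u (b⁻¹ • u) = 1 := by
    rw [herm_smul_right H, inv_pow, hbq, ← hb, inv_mul_cancel₀ huu]
  have hyU : b⁻¹ • u ∈ polar q U' := by
    apply Submodule.smul_mem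
    rw [mem_polar]
    intro x hx
    exact herm_zero_comm H (huU' x hx)
  have hyE : b⁻¹ • u ∈ E := E.smul_mem _ (hUE hu)
  have hyy : herm q (b⁻¹ • u) (b⁻¹ • u) = b⁻¹ := by
    rw [herm_smul_left, hyu, mul_one]
  have hexp : ∀ w, w ∈ polar q U → herm q (w + b⁻¹ • u) (w + b⁻¹ • u) = herm q w w + b⁻¹ := by
    intro w hw
    have h2 : herm q w (b⁻¹ • u) = 0 := mem_polar.1 hw _ (U.smul_mem _ hu)
    rw [herm_add_left, herm_add_right H, herm_add_right H, hyy, h2, herm_zero_comm H h2]; ring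
  refine Finset.card_bij' (fun w _ => w - b⁻¹ • u) (fun w _ => w + b⁻¹ • u) ?_ ?_ ?_ ?_
  · intro w hw
    simp only [Wset, Finset.mem_filter, Finset.mem_univ, true_and] at hw ⊢
    have h3 : w - b⁻¹ • u ∈ polar q U := by
      rw [← hU']
      refine (mem_polar_sup_span H).2 ⟨Submodule.sub_mem _ hw.2.1 hyU, herm_zero_comm H ?_⟩
      rw [herm_sub_right H, hw.2.2.1, hyu, sub_self]
    refine ⟨⟨E.sub_mem hw.1 hyE, h3⟩, ?_⟩
    have := hexp _ h3
    rw [sub_add_cancel, hw.2.2.2] at this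
    exact eq_neg_of_add_eq_zero_left this.symm
  · intro w hw
    simp only [Wset, Finset.mem_filter, Finset.mem_univ, true_and] at hw ⊢
    refine ⟨E.add_mem hw.1.1 hyE, Submodule.add_mem _ (polar_anti hU'U hw.1.2) hyU, ?_, ?_⟩
    · rw [herm_add_right H, hyu, herm_zero_comm H (mem_polar.1 hw.1.2 u hu), zero_add]
    · rw [hexp _ hw.1.2, hw.2]; ring
  · intro w _; simp
  · intro w _; simp

theorem T_count (H : FC q F) (m : ℕ) : ∀ (s : ℕ) (E U : Submodule F (Fin k → F)),
    E ⊓ polar q E = ⊥ → finrank F E = 2 * m → U ≤ E → finrank F U = m →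
    finrank F ↥(U ⊓ polar q U) + s = m →
    (Nat.card {W : Submodule F (Fin k → F) // Lag q E W ∧ W ⊓ U = ⊥} : ℤ) * (q:ℤ) ^ ((s + 1).choose 2) =
      (q:ℤ) ^ (m ^ 2) * ∏ j ∈ Finset.range s, ((q:ℤ) ^ (j + 1) - (-1) ^ (j + 1)) := by
  induction m with
  | zero =>
    intro s E U hE hfE hUE hfU hs
    obtain rfl : s = 0 := by omega
    have hE0 : E = ⊥ := by rw [← Submodule.finrank_eq_zero (R := F)]; omega
    subst hE0
    have : Nat.card {W : Submodule F (Fin k → F) // Lag q ⊥ W ∧ W ⊓ U = ⊥} = 1 := by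
      rw [Nat.card_eq_one_iff_unique]
      refine ⟨⟨?_⟩, ⟨⟨⊥, ?_, ?_⟩⟩⟩
      · rintro ⟨W, hW, _⟩ ⟨W', hW', _⟩
        apply Subtype.ext
        exact (le_bot_iff.1 hW.le).trans (le_bot_iff.1 hW'.le).symm
      · simp [Lag]
      · simp
    rw [this]; simp
  | succ m ih =>
    intro s E U hE hfE hUE hfU hs
    have hq2 := H.two
    by_cases hr : U ⊓ polar q U = ⊥
    · rw [hr, finrank_bot] at hs
      obtain rfl : s = m + 1 := by omega
      obtain ⟨u, huU, huu⟩ := exists_nonisotropic H U (by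
        intro hle
        rw [inf_eq_left.2 hle] at hr
        rw [hr, finrank_bot] at hfU; omega)
      set U' := U ⊓ polar q (Submodule.span F {u}) with hU'
      have hu0 : u ≠ 0 := by rintro rfl; simp at huu
      have hU'u : ∀ x ∈ U', herm q x u = 0 := fun x hx => (polar_span_singleton_mem H).1 hx.2
      have hsup : U' ⊔ Submodule.span F {u} = U := by
        apply le_antisymm
        · refine sup_le inf_le_left ?_
          rw [Submodule.span_singleton_le_iff_mem]; exact huU
        · intro x hx
          have : x = (x - (herm q x u / herm q u u) • u) + (herm q x u / herm q u u) • u := by simp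
          rw [this]
          refine Submodule.add_mem_sup ⟨U.sub_mem hx (U.smul_mem _ huU), (polar_span_singleton_mem H).2 ?_⟩
            (Submodule.smul_mem _ _ (Submodule.mem_span_singleton_self u))
          rw [herm_sub_left, herm_smul_left]; field_simp; ring
      have hfU' : finrank F U' = m := by
        have := finrank_inf_polar H U (Submodule.span F {u}) (nondeg_sub hr (by
          rw [Submodule.span_singleton_le_iff_mem]; exact huU))
        rw [finrank_span_singleton hu0, ← hU'] at this
        omega
      have hU'r : U' ⊓ polar q U' = ⊥ := by
        rw [eq_bot_iff, ← hr]
        rintro x ⟨hx1, hx2⟩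
        refine ⟨hx1.1, ?_⟩
        rw [← hsup]
        exact (mem_polar_sup_span H).2 ⟨hx2, hU'u x hx1⟩
      set T := (q ^ (m ^ 2) * 1 : ℕ) with hTdef
      have hwU : ∀ w ∈ Wset q E U' u, w ∉ U := by
        intro w hw hwU
        simp only [Wset, Finset.mem_filter, Finset.mem_univ, true_and] at hw
        obtain ⟨hw1, hw2, hw3, hw4⟩ := hw
        rw [← hsup] at hwU
        obtain ⟨y, hy, z, hz, rfl⟩ := Submodule.mem_sup.1 hwU
        obtain ⟨t, rfl⟩ := Submodule.mem_span_singleton.1 hz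
        have hyz : y ∈ U' ⊓ polar q U' := by
          refine ⟨hy, ?_⟩
          have h5 : t • u ∈ polar q U' := by
            rw [mem_polar]; intro x hx
            rw [herm_smul_left, herm_zero_comm H (hU'u x hx), mul_zero]
          have := Submodule.sub_mem _ hw2 h5
          simpa using this
        rw [hU'r, Submodule.mem_bot] at hyz
        rw [hyz, zero_add, herm_smul_left, herm_smul_right H] at hw4
        rw [hyz, zero_add, herm_smul_right H] at hw3
        rw [hw3, mul_one] at hw4
        rw [hw4] at hw3
        simp [H.q0] at hw3
      have hih : ∀ w ∈ Wset q E U' u, (Nat.card {W : Submodule F (Fin k → F) //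
          Lag q (E ⊓ polar q (Submodule.span F {u, w})) W ∧ W ⊓ U' = ⊥} : ℤ) * (q:ℤ) ^ ((m + 1).choose 2) =
          (q:ℤ) ^ (m ^ 2) * ∏ j ∈ Finset.range m, ((q:ℤ) ^ (j + 1) - (-1) ^ (j + 1)) := by
        intro w hw
        simp only [Wset, Finset.mem_filter, Finset.mem_univ, true_and] at hw
        obtain ⟨hw1, hw2, hw3, hw4⟩ := hw
        obtain ⟨hM1, hM2⟩ := M_pair H m E u w hE hfE (hUE huU) hw1 hw3 hw4
        refine ih m _ U' hM1 hM2 ?_ hfU' (by rw [hU'r, finrank_bot]; omega)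
        intro x hx
        exact ⟨hUE hx.1, (mem_polar_pair H).2 ⟨hU'u x hx, herm_zero_comm H (mem_polar.1 hw2 x hx)⟩⟩
      have hWc := Wset_card_nondeg H m E U U' u hE hfE hUE hfU huU hsup hU'u hr huu
      have hqz : (q:ℤ) ≠ 0 := by exact_mod_cast H.q0
      by_cases hne : (Wset q E U' u).Nonempty
      · obtain ⟨w0, hw0⟩ := hne
        have hstep := lag_step H m (Nat.card {W : Submodule F (Fin k → F) //
          Lag q (E ⊓ polar q (Submodule.span F {u, w0})) W ∧ W ⊓ U' = ⊥}) E U U' u hE hfE hUE hfU huU hsup hfU' hU'u hwU (by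
          intro w hw
          have h1 := hih w hw
          rw [← hih w0 hw0] at h1
          exact_mod_cast mul_right_cancel₀ (pow_ne_zero _ hqz) h1)
        have h1 := hih w0 hw0
        rw [hstep, Finset.prod_range_succ, Nat.choose_succ_succ' (m+1) 1, Nat.choose_one_right]
        push_cast
        have e1 : (q:ℤ) ^ ((m + 1) ^ 2) = q ^ (m ^ 2) * q ^ m * q ^ (m + 1) := by
          rw [← pow_add, ← pow_add]; congr 1; ring
        rw [pow_add, e1]
        apply mul_left_cancel₀ hqz
        linear_combination (Nat.card {W : Submodule F (Fin k → F) //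
          Lag q (E ⊓ polar q (Submodule.span F {u, w0})) W ∧ W ⊓ U' = ⊥} : ℤ) * (q:ℤ) ^ (m+1) * (q:ℤ) ^ ((m + 1).choose 2) * hWc +
          ((q:ℤ) ^ (2 * (m + 1)) - (-1) ^ (m + 1) * (q:ℤ) ^ (m + 1)) * (q:ℤ) ^ (m+1) * h1
      · exfalso
        rw [Finset.not_nonempty_iff_eq_empty] at hne
        rw [hne] at hWc
        simp only [Finset.card_empty, Nat.cast_zero, mul_zero] at hWc
        have : (q:ℤ) ^ (m + 1) * ((q:ℤ) ^ (m + 1) - (-1) ^ (m + 1)) = 0 := by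
          rw [hWc]; ring
        rcases mul_eq_zero.1 this with h | h
        · exact pow_ne_zero _ hqz h
        · have h2 : (1:ℤ) < (q:ℤ) ^ (m + 1) := by
            apply one_lt_pow₀ (by exact_mod_cast hq2) (by omega)
          rcases neg_one_pow_eq_or ℤ (m+1) with h3 | h3 <;> rw [h3] at h <;> omega
    · obtain ⟨u, hu, hu0⟩ := (Submodule.ne_bot_iff _).1 hr
      obtain ⟨huU, huP⟩ := hu
      have hspan : Submodule.span F {u} ≤ U := by
        rw [Submodule.span_singleton_le_iff_mem]; exact huU
      obtain ⟨U1, hU1⟩ := Submodule.exists_isCompl (Submodule.span F {u})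
      set U' := U1 ⊓ U with hU'
      have hsup : U' ⊔ Submodule.span F {u} = U := by
        rw [sup_comm, hU', ← sup_inf_assoc_of_le _ hspan, hU1.sup_eq_top, top_inf_eq]
      have hinf : U' ⊓ Submodule.span F {u} = ⊥ := by
        rw [eq_bot_iff, ← hU1.inf_eq_bot]
        exact le_inf inf_le_right (inf_le_left.trans inf_le_left)
      have hU'u : ∀ x ∈ U', herm q x u = 0 := fun x hx => herm_zero_comm H (mem_polar.1 huP x hx.2)
      have hfU' : finrank F U' = m := by
        have := Submodule.finrank_sup_add_finrank_inf_eq U' (Submodule.span F {u})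
        rw [hsup, hinf, finrank_bot, finrank_span_singleton hu0] at this
        omega
      have huP' : Submodule.span F {u} ≤ polar q U := by
        rw [Submodule.span_singleton_le_iff_mem]; exact huP
      have hU'r : finrank F ↥(U' ⊓ polar q U') + s = m := by
        have h1 : U' ⊓ polar q U' = U' ⊓ polar q U := by
          apply le_antisymm
          · rintro x ⟨hx1, hx2⟩
            refine ⟨hx1, ?_⟩
            rw [← hsup]
            exact (mem_polar_sup_span H).2 ⟨hx2, hU'u x hx1⟩
          · exact inf_le_inf_left _ (polar_anti inf_le_right)
        have h2 : (U' ⊓ polar q U) ⊔ Submodule.span F {u} = U ⊓ polar q U := by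
          rw [sup_comm, ← sup_inf_assoc_of_le _ huP', sup_comm, hsup]
        have h3 : (U' ⊓ polar q U) ⊓ Submodule.span F {u} = ⊥ := by
          rw [eq_bot_iff, ← hinf]
          exact inf_le_inf_right _ inf_le_left
        have := Submodule.finrank_sup_add_finrank_inf_eq (U' ⊓ polar q U) (Submodule.span F {u})
        rw [h2, h3, finrank_bot, finrank_span_singleton hu0] at this
        rw [h1]; omega
      have hwU : ∀ w ∈ Wset q E U' u, w ∉ U := by
        intro w hw hwU
        simp only [Wset, Finset.mem_filter, Finset.mem_univ, true_and] at hw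
        rw [mem_polar.1 huP w hwU] at hw
        simp at hw
      have hih : ∀ w ∈ Wset q E U' u, (Nat.card {W : Submodule F (Fin k → F) //
          Lag q (E ⊓ polar q (Submodule.span F {u, w})) W ∧ W ⊓ U' = ⊥} : ℤ) * (q:ℤ) ^ ((s + 1).choose 2) =
          (q:ℤ) ^ (m ^ 2) * ∏ j ∈ Finset.range s, ((q:ℤ) ^ (j + 1) - (-1) ^ (j + 1)) := by
        intro w hw
        simp only [Wset, Finset.mem_filter, Finset.mem_univ, true_and] at hw
        obtain ⟨hw1, hw2, hw3, hw4⟩ := hw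
        obtain ⟨hM1, hM2⟩ := M_pair H m E u w hE hfE (hUE huU) hw1 hw3 hw4
        refine ih s _ U' hM1 hM2 ?_ hfU' hU'r
        intro x hx
        exact ⟨hUE hx.2, (mem_polar_pair H).2 ⟨hU'u x hx, herm_zero_comm H (mem_polar.1 hw2 x hx)⟩⟩
      have hWc := Wset_card_rad H m E U U' u hE hfE hUE hfU huU hsup hfU' huP
      have hqz : (q:ℤ) ≠ 0 := by exact_mod_cast H.q0
      have hne : (Wset q E U' u).Nonempty := by
        rw [← Finset.card_pos, hWc]; exact pow_pos (by omega) _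
      obtain ⟨w0, hw0⟩ := hne
      have hstep := lag_step H m (Nat.card {W : Submodule F (Fin k → F) //
        Lag q (E ⊓ polar q (Submodule.span F {u, w0})) W ∧ W ⊓ U' = ⊥}) E U U' u hE hfE hUE hfU huU hsup hfU' hU'u hwU (by
        intro w hw
        have h1 := hih w hw
        rw [← hih w0 hw0] at h1
        exact_mod_cast mul_right_cancel₀ (pow_ne_zero _ hqz) h1)
      have h1 := hih w0 hw0
      rw [hstep, hWc]
      push_cast
      have e1 : (q:ℤ) ^ ((m + 1) ^ 2) = q ^ (m ^ 2) * q ^ (2 * m + 1) := by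
        rw [← pow_add]; congr 1; ring
      rw [e1]
      linear_combination (q:ℤ) ^ (2 * m + 1) * h1

end
end HermCode

namespace HermCode
open Module
section
variable {q : ℕ} {F : Type} [Field F] [Fintype F] {k : ℕ}

open Classical in
theorem X_count (H : FC q F) (U : Submodule F (Fin k → F)) (a : Fin k → F) (ha : a ∈ U)
    (haa : herm q a a ≠ 0) (r e : ℕ) (hr : finrank F ↥(U ⊓ polar q U) = r)
    (hU : finrank F U = r + e + 2) :
    ((Finset.univ.filter (fun x : Fin k → F => x ∈ U ∧ x ∉ polar q U ∧ herm q x x = 0 ∧ herm q x a = 0)).card : ℤ)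
      = (q:ℤ) ^ (2 * r) * (((q:ℤ) ^ (e + 1) - (-1) ^ (e + 1)) * ((q:ℤ) ^ e - (-1) ^ e)) := by
  have hq2 := H.two
  have ha0 : a ≠ 0 := by rintro rfl; simp at haa
  set E := U ⊓ polar q (Submodule.span F {a}) with hEdef
  have hmE : ∀ x, x ∈ E ↔ x ∈ U ∧ herm q x a = 0 := by
    intro x; rw [hEdef, Submodule.mem_inf, polar_span_singleton_mem H]
  have hrad : E ⊓ polar q E = U ⊓ polar q U := by
    apply le_antisymm
    · rintro x ⟨hx1, hx2⟩
      have hx1' := (hmE x).1 hx1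
      refine ⟨hx1'.1, mem_polar.2 fun u hu => ?_⟩
      have hu' : u - (herm q u a / herm q a a) • a ∈ E := by
        rw [hmE]
        refine ⟨U.sub_mem hu (U.smul_mem _ ha), ?_⟩
        rw [herm_sub_left, herm_smul_left]; field_simp; ring
      have h1 := mem_polar.1 hx2 _ hu'
      rw [herm_sub_right H, herm_smul_right H, hx1'.2] at h1
      simpa using h1
    · rintro x ⟨hx1, hx2⟩
      exact ⟨(hmE x).2 ⟨hx1, mem_polar.1 hx2 a ha⟩, polar_anti inf_le_left hx2⟩
  have hfE : finrank F E + 1 = finrank F U := by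
    have := finrank_inf_polar H U (Submodule.span F {a}) (by
      rw [eq_bot_iff]
      rintro x ⟨hx1, hx2⟩
      obtain ⟨c, rfl⟩ := Submodule.mem_span_singleton.1 hx1
      have h1 := mem_polar.1 hx2 a ha
      rw [herm_smul_left] at h1
      have : c = 0 := by simpa [haa] using h1
      simp [this])
    rwa [finrank_span_singleton ha0, ← hEdef] at this
  have hc := norm_count H (e + 1) E r (by rw [hrad, hr]) (by omega) 0 (zero_pow H.q0)
  have hR := card_mem H (U ⊓ polar q U)
  rw [hr] at hR
  have hsplit : (Finset.univ.filter (fun x : Fin k → F => x ∈ E ∧ herm q x x = 0)).card =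
      (Finset.univ.filter (fun x : Fin k → F => x ∈ U ∧ x ∉ polar q U ∧ herm q x x = 0 ∧ herm q x a = 0)).card
      + (Finset.univ.filter (fun x : Fin k → F => x ∈ U ⊓ polar q U)).card := by
    rw [← Finset.card_union_of_disjoint]
    · congr 1
      ext x
      simp only [Finset.mem_filter, Finset.mem_univ, true_and, Finset.mem_union, hmE, Submodule.mem_inf]
      constructor
      · rintro ⟨⟨h1, h2⟩, h3⟩
        by_cases hx : x ∈ polar q U
        · exact Or.inr ⟨h1, hx⟩
        · exact Or.inl ⟨h1, hx, h3, h2⟩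
      · rintro (⟨h1, h2, h3, h4⟩ | ⟨h1, h2⟩)
        · exact ⟨⟨h1, h4⟩, h3⟩
        · exact ⟨⟨h1, mem_polar.1 h2 a ha⟩, mem_polar.1 h2 x h1⟩
    · rw [Finset.disjoint_left]
      intro x hx hx'
      simp only [Finset.mem_filter, Finset.mem_univ, true_and, Submodule.mem_inf] at hx hx'
      exact hx.2.1 hx'.2
  rw [hsplit, hR] at hc
  push_cast at hc
  rw [if_pos rfl] at hc
  have hq0 : (q:ℤ) ≠ 0 := by exact_mod_cast H.q0
  apply mul_left_cancel₀ hq0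
  have h1 : ((-1:ℤ) ^ e) ^ 2 = 1 := by rw [← pow_mul, mul_comm, pow_mul]; simp
  rw [pow_succ (-1:ℤ) e] at hc ⊢
  linear_combination hc + (q:ℤ) * (q:ℤ)^(2*r) * h1

/-- data -/
structure Dat (q : ℕ) (F : Type) [Field F] (k : ℕ) (U : Submodule F (Fin k → F)) (a b : Fin k → F) : Prop where
  ha : a ∈ U
  hb : b ∈ polar q U
  haa : herm q a a ≠ 0
  hbb : herm q b b ≠ 0
  hv : herm q (a + b) (a + b) = 0

variable {U : Submodule F (Fin k → F)} {a b x y : Fin k → F}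

theorem UP (H : FC q F) {u w : Fin k → F} (hu : u ∈ U) (hw : w ∈ polar q U) : herm q u w = 0 :=
  herm_zero_comm H (mem_polar.1 hw u hu)

theorem PU {u w : Fin k → F} (hu : u ∈ U) (hw : w ∈ polar q U) : herm q w u = 0 :=
  mem_polar.1 hw u hu

structure Pt (q : ℕ) (F : Type) [Field F] (k : ℕ) (U : Submodule F (Fin k → F)) (a b x y : Fin k → F) : Prop where
  hx : x ∈ U
  hx' : x ∉ polar q U
  hxx : herm q x x = 0
  hxa : herm q x a = 0
  hy : y ∈ polar q U
  hy' : y ∉ U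
  hyy : herm q y y = 0
  hyb : herm q y b = 0

def LL {F : Type} [Field F] {k : ℕ} (a b x y : Fin k → F) : Submodule F (Fin k → F) :=
  Submodule.span F {a + b, x, y}

theorem mem_LL {z : Fin k → F} : z ∈ LL a b x y ↔ ∃ α β γ : F, α • (a + b) + (β • x + γ • y) = z := by
  rw [LL, Submodule.mem_span_triple]
  simp only [add_assoc]

theorem LL_polar (H : FC q F) (D : Dat q F k U a b) (Q : Pt q F k U a b x y) :
    LL a b x y ≤ polar q (LL a b x y) := by
  have hvx : herm q x (a + b) = 0 := by
    rw [herm_add_right H, Q.hxa, UP H Q.hx D.hb, add_zero]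
  have hvy : herm q y (a + b) = 0 := by
    rw [herm_add_right H, Q.hyb, PU D.ha Q.hy, add_zero]
  have hxy := UP H Q.hx Q.hy
  conv_lhs => rw [LL]
  rw [Submodule.span_le]
  rintro z (rfl | rfl | rfl) <;> refine (mem_polar_span H).2 ?_ <;> rintro w (rfl | rfl | rfl)
  · exact D.hv
  · exact herm_zero_comm H hvx
  · exact herm_zero_comm H hvy
  · exact hvx
  · exact Q.hxx
  · exact hxy
  · exact hvy
  · exact herm_zero_comm H hxy
  · exact Q.hyy

theorem LL_finrank (H : FC q F) (D : Dat q F k U a b) (Q : Pt q F k U a b x y) :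
    finrank F (LL a b x y) = 3 := by
  have hli : LinearIndependent F ![a + b, x, y] := by
    rw [Fintype.linearIndependent_iff]
    intro g hg
    rw [Fin.sum_univ_three] at hg
    change g 0 • (a + b) + g 1 • x + g 2 • y = 0 at hg
    have h1 := congrArg (fun z => herm q z a) hg
    simp only [herm_add_left, herm_smul_left, Q.hxa, PU D.ha Q.hy, PU D.ha D.hb, herm_zero_left] at h1
    have h0 : g 0 = 0 := by simpa [D.haa] using h1
    rw [h0, zero_smul, zero_add] at hg
    have h2 : g 1 = 0 := by
      by_contra hne
      apply Q.hx'
      have : g 1 • x = - (g 2 • y) := eq_neg_of_add_eq_zero_left hg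
      rw [← Submodule.smul_mem_iff _ hne, this]
      exact Submodule.neg_mem _ (Submodule.smul_mem _ _ Q.hy)
    have h3 : g 2 = 0 := by
      rw [h2, zero_smul, zero_add] at hg
      rcases smul_eq_zero.1 hg with h | h
      · exact h
      · exact absurd (h ▸ U.zero_mem) Q.hy'
    intro i; fin_cases i
    · exact h0
    · exact h2
    · exact h3
  have := finrank_span_eq_card hli
  rw [Matrix.range_cons, Matrix.range_cons, Matrix.range_cons, Matrix.range_empty, Set.union_empty,
    Set.singleton_union, Set.singleton_union] at this
  rw [LL, this]; rfl

theorem LL_inf (H : FC q F) (D : Dat q F k U a b) (Q : Pt q F k U a b x y) :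
    U ⊓ LL a b x y = Submodule.span F {x} := by
  apply le_antisymm
  · rintro z ⟨hz, hz2⟩
    obtain ⟨α, β, γ, rfl⟩ := mem_LL.1 hz2
    have h1 := UP H hz D.hb
    simp only [herm_add_left, herm_smul_left, Q.hyb, UP H D.ha D.hb, UP H Q.hx D.hb] at h1
    have h0 : α = 0 := by simpa [D.hbb] using h1
    subst h0
    rw [zero_smul, zero_add] at hz ⊢
    have h2 : γ = 0 := by
      by_contra hne
      apply Q.hy'
      rw [← Submodule.smul_mem_iff _ hne]
      have := U.sub_mem hz (U.smul_mem β Q.hx)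
      simpa using this
    rw [h2, zero_smul, add_zero]
    exact Submodule.smul_mem _ _ (Submodule.mem_span_singleton_self x)
  · rw [Submodule.span_singleton_le_iff_mem]
    exact ⟨Q.hx, Submodule.subset_span (by simp)⟩

theorem S_inf (D : Dat q F k U a b) (Q : Pt q F k U a b x y) :
    Submodule.span F {x, a} ⊓ polar q U = ⊥ := by
  rw [eq_bot_iff]
  rintro z ⟨hz, hz2⟩
  obtain ⟨β, α, rfl⟩ := Submodule.mem_span_pair.1 hz
  have h1 := PU D.ha hz2
  simp only [herm_add_left, herm_smul_left, Q.hxa] at h1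
  have h0 : α = 0 := by simpa [D.haa] using h1
  subst h0
  rw [zero_smul, add_zero] at hz2 ⊢
  have : β = 0 := by
    by_contra hne
    exact Q.hx' ((Submodule.smul_mem_iff _ hne).1 hz2)
  simp [this]

theorem S_finrank (D : Dat q F k U a b) (Q : Pt q F k U a b x y) :
    finrank F (Submodule.span F {x, a}) = 2 := by
  have hli : LinearIndependent F ![x, a] := by
    rw [LinearIndependent.pair_iff]
    intro s t hab
    have h2 := congrArg (fun z => herm q z a) hab
    simp only [herm_add_left, herm_smul_left, Q.hxa, herm_zero_left] at h2
    have h0 : t = 0 := by simpa [D.haa] using h2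
    rw [h0, zero_smul, add_zero] at hab
    refine ⟨?_, h0⟩
    rcases smul_eq_zero.1 hab with h | h
    · exact h
    · exact absurd (h ▸ Submodule.zero_mem _) Q.hx'
  have := finrank_span_eq_card hli
  rw [Matrix.range_cons, Matrix.range_cons, Matrix.range_empty, Set.union_empty, Set.singleton_union] at this
  rw [this]; rfl

theorem U1_eq (H : FC q F) (D : Dat q F k U a b) (Q : Pt q F k U a b x y) :
    U ⊓ polar q (LL a b x y) = U ⊓ polar q (Submodule.span F {x, a}) := by
  ext u
  simp only [Submodule.mem_inf, LL, mem_polar_span H, Set.mem_insert_iff, Set.mem_singleton_iff,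
    forall_eq_or_imp, forall_eq, herm_add_right H]
  constructor
  · rintro ⟨hu, h1, h2, h3⟩
    rw [UP H hu D.hb, add_zero] at h1
    exact ⟨hu, h2, h1⟩
  · rintro ⟨hu, h1, h2⟩
    refine ⟨hu, ?_, h1, UP H hu Q.hy⟩
    rw [UP H hu D.hb, h2, add_zero]

theorem sub_M {L M Z : Submodule F (Fin k → F)} (hZ : Z ≤ M ⊔ L) (hML0 : M ⊓ L = ⊥) :
    (Z ⊔ L) ⊓ M ⊔ L = Z ⊔ L ∧
    finrank F ↥((Z ⊔ L) ⊓ M) + finrank F ↥(Z ⊓ L) = finrank F Z := by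
  have h1 : (Z ⊔ L) ⊓ M ⊔ L = Z ⊔ L := by
    rw [inf_sup_assoc_of_le _ le_sup_right]
    exact inf_eq_left.2 (sup_le hZ le_sup_right)
  refine ⟨h1, ?_⟩
  have h2 := Submodule.finrank_sup_add_finrank_inf_eq ((Z ⊔ L) ⊓ M) L
  have h3 := Submodule.finrank_sup_add_finrank_inf_eq Z L
  have h4 : (Z ⊔ L) ⊓ M ⊓ L = ⊥ := by
    rw [eq_bot_iff, ← hML0]
    exact inf_le_inf_right _ inf_le_right
  rw [h1, h4, finrank_bot] at h2
  omega

theorem below_count (H : FC q F) (D : Dat q F k U a b) (Q : Pt q F k U a b x y) (m s : ℕ)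
    (hk : k = 2 * m + 6) (hU : finrank F U = m + 3) (hR : finrank F ↥(U ⊓ polar q U) + s = m) :
    (Nat.card {W : Submodule F (Fin k → F) // Lag q ⊤ W ∧ LL a b x y ≤ W ∧ W ⊓ U ≤ LL a b x y} : ℤ)
      * (q:ℤ) ^ ((s + 1).choose 2) =
      (q:ℤ) ^ (m ^ 2) * ∏ j ∈ Finset.range s, ((q:ℤ) ^ (j + 1) - (-1) ^ (j + 1)) := by
  have hLp := LL_polar H D Q
  have hLf := LL_finrank H D Q
  have hLi := LL_inf H D Q
  have hU1 := U1_eq H D Q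
  have hSf := S_finrank D Q
  have hSi := S_inf D Q
  have htop : (⊤ : Submodule F (Fin k → F)) ⊓ polar q ⊤ = ⊥ := by rw [polar_top H]; simp
  set L := LL a b x y with hL
  set S := Submodule.span F {x, a} with hS
  obtain ⟨C, hC⟩ := Submodule.exists_isCompl L
  have hML : (C ⊓ polar q L) ⊔ L = ⊤ ⊓ polar q L := by
    rw [sup_comm, ← sup_inf_assoc_of_le _ hLp, hC.sup_eq_top]
  have hML0 : (C ⊓ polar q L) ⊓ L = ⊥ := by
    rw [eq_bot_iff, ← hC.inf_eq_bot]
    exact le_inf inf_le_right (inf_le_left.trans inf_le_left)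
  set M := C ⊓ polar q L with hM
  rw [lag_card H ⊤ L M U le_top hLp hML hML0]
  have hMf := M_finrank H ⊤ L M htop le_top hML hML0
  rw [finrank_top, Module.finrank_fin_fun] at hMf
  have hMp : M ≤ polar q L := inf_le_right
  have hML' : M ⊔ L = polar q L := by rw [hML, top_inf_eq]
  set U1 := U ⊓ polar q L with hU1d
  have hfU1 : finrank F U1 + 2 = finrank F U := by
    rw [hU1, ← hSf]; exact finrank_inf_polar H U S hSi
  have hx0 : x ≠ 0 := by rintro rfl; exact Q.hx' (Submodule.zero_mem _)
  have hxL : x ∈ L := Submodule.subset_span (by simp)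
  have hU1L : U1 ⊓ L = Submodule.span F {x} := by
    rw [← hLi]
    apply le_antisymm
    · exact inf_le_inf_right _ inf_le_left
    · exact le_inf (le_inf inf_le_left (inf_le_right.trans hLp)) inf_le_right
  obtain ⟨hA1, hA2⟩ := sub_M (L := L) (M := M) (Z := U1) (by rw [hML']; exact inf_le_right) hML0
  rw [hU1L, finrank_span_singleton hx0] at hA2
  have hRU1 : U ⊓ polar q U ≤ U1 := by
    rw [hU1]
    refine le_inf inf_le_left (inf_le_right.trans (polar_anti ?_))
    rw [hS, Submodule.span_le]
    rintro z (rfl | rfl)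
    · exact Q.hx
    · exact D.ha
  have hRL : (U ⊓ polar q U) ⊓ L = ⊥ := by
    rw [eq_bot_iff, ← hSi]
    refine le_inf ?_ (inf_le_left.trans inf_le_right)
    have : U ⊓ polar q U ⊓ L ≤ Submodule.span F {x} := by
      rw [← hLi]; exact inf_le_inf_right _ inf_le_left
    exact this.trans (Submodule.span_mono (by simp))
  obtain ⟨-, hB2⟩ := sub_M (L := L) (M := M) (Z := U ⊓ polar q U)
    (by rw [hML']; exact hRU1.trans inf_le_right) hML0
  rw [hRL, finrank_bot, add_zero] at hB2
  have hLU1 : L ≤ polar q U1 := le_polar_comm H inf_le_right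
  have hrad : ((U1 ⊔ L) ⊓ M) ⊓ polar q ((U1 ⊔ L) ⊓ M) = ((U ⊓ polar q U) ⊔ L) ⊓ M := by
    apply le_antisymm
    · rintro p ⟨⟨hp1, hp2⟩, hp3⟩
      refine ⟨?_, hp2⟩
      have hp4 : p ∈ polar q U1 := by
        have : p ∈ polar q ((U1 ⊔ L) ⊓ M ⊔ L) := by
          rw [polar_sup H]; exact ⟨hp3, hMp hp2⟩
        rw [hA1] at this
        exact polar_anti le_sup_left this
      obtain ⟨u, hu, l, hl, rfl⟩ := Submodule.mem_sup.1 hp1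
      have hu2 : u ∈ polar q U1 := by
        have := Submodule.sub_mem _ hp4 (hLU1 hl)
        simpa using this
      have hpp : polar q U1 = polar q U ⊔ S := by
        rw [hU1, ← polar_polar H (polar q U ⊔ S), polar_sup H, polar_polar H]
      rw [hpp] at hu2
      obtain ⟨t, ht, z, hz, htz⟩ := Submodule.mem_sup.1 hu2
      obtain ⟨β, α, rfl⟩ := Submodule.mem_span_pair.1 hz
      have hua : herm q u a = 0 := by
        rw [hU1] at hu
        exact mem_polar.1 hu.2 a (Submodule.subset_span (by simp))
      rw [← htz] at hua
      simp only [herm_add_left, herm_smul_left, Q.hxa, PU D.ha ht] at hua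
      have h0 : α = 0 := by simpa [D.haa] using hua
      rw [h0, zero_smul, add_zero] at htz
      rw [← htz, add_assoc]
      refine Submodule.add_mem_sup ⟨?_, ht⟩ (L.add_mem (L.smul_mem _ hxL) hl)
      have := U.sub_mem hu.1 (U.smul_mem β Q.hx)
      rw [← htz] at this
      simpa using this
    · refine le_inf (inf_le_inf_right _ (sup_le_sup_right hRU1 _)) ?_
      refine inf_le_left.trans (le_trans ?_ (polar_anti inf_le_left))
      rw [polar_sup H]
      refine sup_le (le_inf ?_ ?_) (le_inf hLU1 hLp)
      · exact inf_le_right.trans (polar_anti inf_le_left)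
      · exact hRU1.trans inf_le_right
  refine T_count H m s M ((U1 ⊔ L) ⊓ M) (M_nondeg H ⊤ L M htop le_top hML hML0) (by omega)
    inf_le_right (by omega) ?_
  rw [hrad, hB2]; exact hR

end
end HermCode

namespace HermCode
open Module
section
variable {q : ℕ} {F : Type} [Field F] [Fintype F] {k : ℕ}

theorem exU_iff (Z T : Submodule F (Fin k → F)) :
    (∃! R : Submodule F (Fin k → F), finrank F R = 1 ∧ R ≤ Z ∧ ¬ R ≤ T) ↔
      finrank F Z = 1 ∧ ¬ Z ≤ T := by
  constructor
  · rintro ⟨R, ⟨hR1, hRZ, hRT⟩, huniq⟩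
    obtain ⟨x, hxR, hxT⟩ := SetLike.not_le_iff_exists.1 hRT
    have key : ∀ w ∈ Z, w ∉ T → w ∈ R := by
      intro w hw hwT
      have hw0 : w ≠ 0 := by rintro rfl; exact hwT T.zero_mem
      have := huniq (Submodule.span F {w}) ⟨finrank_span_singleton hw0,
        (Submodule.span_singleton_le_iff_mem _ _).2 hw,
        fun h => hwT ((Submodule.span_singleton_le_iff_mem _ _).1 h)⟩
      rw [← this]; exact Submodule.mem_span_singleton_self w
    have : Z = R := by
      refine le_antisymm (fun z hz => ?_) hRZ
      by_cases hzT : z ∈ T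
      · have h1 : x + z ∈ R := key _ (Z.add_mem (hRZ hxR) hz) (fun h => hxT (by
          have := T.sub_mem h hzT
          simpa using this))
        have := R.sub_mem h1 hxR
        simpa using this
      · exact key z hz hzT
    rw [this]; exact ⟨hR1, hRT⟩
  · rintro ⟨h1, h2⟩
    exact ⟨Z, ⟨h1, le_rfl, h2⟩, fun R hR => Submodule.eq_of_le_of_finrank_eq hR.2.1 (by rw [hR.1, h1])⟩

theorem top_nondeg (H : FC q F) : (⊤ : Submodule F (Fin k → F)) ⊓ polar q ⊤ = ⊥ := by
  rw [polar_top H]; simp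

theorem gen_iff (H : FC q F) (n : ℕ) (W : Submodule F (Fin (2*n+2) → F)) :
    IsGenerator q n W ↔ Lag q ⊤ W := by
  constructor
  · rintro ⟨h1, h2⟩
    have hle : W ≤ polar q W := by
      by_contra h
      obtain ⟨e, he, hee⟩ := exists_nonisotropic H W h
      exact hee (h2 e he)
    rw [Lag, top_inf_eq]
    apply Submodule.eq_of_le_of_finrank_eq hle
    have := finrank_inf_polar H ⊤ W (nondeg_sub (top_nondeg H) le_top)
    rw [top_inf_eq, finrank_top, Module.finrank_fin_fun] at this
    omega
  · intro h
    have := lag_finrank H (top_nondeg H) h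
    rw [finrank_top, Module.finrank_fin_fun] at this
    exact ⟨by omega, fun x hx => mem_polar.1 (h.le_polar hx) x hx⟩

theorem lag_dims (H : FC q F) (n : ℕ) (hk : k = 2 * n + 2) (W U : Submodule F (Fin k → F))
    (hW : Lag q ⊤ W) (hU : finrank F U = n + 1) :
    finrank F ↥(W ⊓ polar q U) = finrank F ↥(W ⊓ U) := by
  have h1 := lag_finrank H (top_nondeg H) hW
  have h2 := lag_inf_polar H (top_nondeg H) hW (le_top : U ≤ ⊤)
  have h3 := Submodule.finrank_sup_add_finrank_inf_eq W U
  rw [finrank_top, Module.finrank_fin_fun] at h1 h2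
  omega

open Classical in
theorem card_nz (H : FC q F) (Z : Submodule F (Fin k → F)) (hZ : finrank F Z = 1) :
    (Finset.univ.filter (fun x : Fin k → F => x ∈ Z ∧ x ≠ 0)).card = q ^ 2 - 1 := by
  have h := card_mem H Z
  rw [hZ, mul_one] at h
  rw [← h, ← Finset.card_erase_of_mem (a := (0 : Fin k → F)) (by simp)]
  congr 1
  ext x
  simp [and_comm]

theorem mem_one {Z T : Submodule F (Fin k → F)} (hZ : finrank F Z = 1) (hT : ¬ Z ≤ T) {x : Fin k → F}
    (hx : x ∈ Z) (hx0 : x ≠ 0) : x ∉ T := by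
  intro h
  apply hT
  have : Submodule.span F {x} = Z := Submodule.eq_of_le_of_finrank_eq
    ((Submodule.span_singleton_le_iff_mem _ _).2 hx) (by rw [hZ, finrank_span_singleton hx0])
  rw [← this, Submodule.span_singleton_le_iff_mem]; exact h

theorem good_count (H : FC q F) {U : Submodule F (Fin k → F)} {a b : Fin k → F} (D : Dat q F k U a b)
    (m s : ℕ) (hk : k = 2 * m + 6) (hU : finrank F U = m + 3) (r : ℕ)
    (hR : finrank F ↥(U ⊓ polar q U) = r) (hrs : r + s = m) :
    (Nat.card {W : Submodule F (Fin k → F) // Lag q ⊤ W ∧ a + b ∈ W ∧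
        (finrank F ↥(W ⊓ U) = 1 ∧ ¬ W ⊓ U ≤ polar q U) ∧ ¬ W ⊓ polar q U ≤ U} : ℤ)
      * ((q:ℤ) ^ 2 - 1) ^ 2 * (q:ℤ) ^ ((s + 1).choose 2) =
      ((q:ℤ) ^ (2 * r) * (((q:ℤ) ^ (s + 2) - (-1) ^ (s + 2)) * ((q:ℤ) ^ (s + 1) - (-1) ^ (s + 1)))) ^ 2 *
      ((q:ℤ) ^ (m ^ 2) * ∏ j ∈ Finset.range s, ((q:ℤ) ^ (j + 1) - (-1) ^ (j + 1))) := by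
  classical
  have hq2 := H.two
  have : Fintype (Submodule F (Fin k → F)) := Fintype.ofFinite _
  have hfU' : finrank F (polar q U) = m + 3 := by
    have := finrank_inf_polar H ⊤ U (nondeg_sub (top_nondeg H) le_top)
    rw [top_inf_eq, finrank_top, Module.finrank_fin_fun] at this
    omega
  have hX := X_count H U a D.ha D.haa r (s + 1) hR (by omega)
  have hY := X_count H (polar q U) b D.hb D.hbb r (s + 1) (by rw [polar_polar H, inf_comm]; exact hR)
    (by omega)
  rw [polar_polar H] at hY
  set X := Finset.univ.filter (fun x : Fin k → F => x ∈ U ∧ x ∉ polar q U ∧ herm q x x = 0 ∧ herm q x a = 0)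
  set Y := Finset.univ.filter (fun x : Fin k → F => x ∈ polar q U ∧ x ∉ U ∧ herm q x x = 0 ∧ herm q x b = 0)
  set G := Finset.univ.filter (fun W : Submodule F (Fin k → F) => Lag q ⊤ W ∧ a + b ∈ W ∧
        (finrank F ↥(W ⊓ U) = 1 ∧ ¬ W ⊓ U ≤ polar q U) ∧ ¬ W ⊓ polar q U ≤ U) with hG
  -- multiply by q^choose to have a constant
  have hPt : ∀ z ∈ X ×ˢ Y, Pt q F k U a b z.1 z.2 := by
    rintro ⟨x, y⟩ hz
    simp only [X, Y, Finset.mem_product, Finset.mem_filter, Finset.mem_univ, true_and] at hz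
    exact ⟨hz.1.1, hz.1.2.1, hz.1.2.2.1, hz.1.2.2.2, hz.2.1, hz.2.2.1, hz.2.2.2.1, hz.2.2.2.2⟩
  have hbelow : ∀ z ∈ X ×ˢ Y, ((Finset.bipartiteBelow
      (fun (W : Submodule F (Fin k → F)) (z : (Fin k → F) × (Fin k → F)) => z.1 ∈ W ∧ z.2 ∈ W) G z).card : ℤ)
      * (q:ℤ) ^ ((s + 1).choose 2) =
      (q:ℤ) ^ (m ^ 2) * ∏ j ∈ Finset.range s, ((q:ℤ) ^ (j + 1) - (-1) ^ (j + 1)) := by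
    intro z hz
    have Q := hPt z hz
    rw [← below_count H D Q m s hk hU (by omega), Nat.card_eq_fintype_card, Fintype.card_subtype]
    congr 3
    ext W
    simp only [Finset.bipartiteBelow, hG, Finset.mem_filter, Finset.mem_univ, true_and]
    have hx0 : z.1 ≠ 0 := fun h => Q.hx' (h ▸ Submodule.zero_mem _)
    constructor
    · rintro ⟨⟨h1, h2, ⟨h3, h4⟩, h5⟩, h6, h7⟩
      refine ⟨h1, ?_, ?_⟩
      · rw [LL, Submodule.span_le]
        rintro w (rfl | rfl | rfl)
        · exact h2
        · exact h6
        · exact h7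
      · have : Submodule.span F {z.1} = W ⊓ U := Submodule.eq_of_le_of_finrank_eq
          ((Submodule.span_singleton_le_iff_mem _ _).2 ⟨h6, Q.hx⟩) (by rw [h3, finrank_span_singleton hx0])
        rw [← this, LL]
        exact Submodule.span_mono (by simp)
    · rintro ⟨h1, h2, h3⟩
      have hx : z.1 ∈ W := h2 (Submodule.subset_span (by simp))
      have hy : z.2 ∈ W := h2 (Submodule.subset_span (by simp))
      refine ⟨⟨h1, h2 (Submodule.subset_span (by simp)), ⟨?_, ?_⟩, ?_⟩, hx, hy⟩
      · have : W ⊓ U = Submodule.span F {z.1} := by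
          apply le_antisymm
          · rw [← LL_inf H D Q]; exact le_inf inf_le_right h3
          · rw [Submodule.span_singleton_le_iff_mem]; exact ⟨hx, Q.hx⟩
        rw [this, finrank_span_singleton hx0]
      · intro h; exact Q.hx' (h ⟨hx, Q.hx⟩)
      · intro h; exact Q.hy' (h ⟨hy, Q.hy⟩)
  have habove : ∀ W ∈ G, (Finset.bipartiteAbove
      (fun (W : Submodule F (Fin k → F)) (z : (Fin k → F) × (Fin k → F)) => z.1 ∈ W ∧ z.2 ∈ W) (X ×ˢ Y) W).card
      = (q ^ 2 - 1) ^ 2 := by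
    intro W hW
    simp only [hG, Finset.mem_filter, Finset.mem_univ, true_and] at hW
    obtain ⟨h1, h2, ⟨h3, h4⟩, h5⟩ := hW
    have h6 : finrank F ↥(W ⊓ polar q U) = 1 := by
      rw [lag_dims H (m + 2) (by omega) W U h1 (by omega), h3]
    have hWW : ∀ x ∈ W, ∀ y ∈ W, herm q x y = 0 := fun x hx y hy => mem_polar.1 (h1.le_polar hx) y hy
    rw [sq, ← card_nz H (W ⊓ U) h3]
    nth_rewrite 2 [card_nz H (W ⊓ U) h3]
    rw [← card_nz H (W ⊓ polar q U) h6, ← Finset.card_product]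
    congr 1
    ext ⟨x, y⟩
    simp only [Finset.bipartiteAbove, X, Y, Finset.mem_product, Finset.mem_filter, Finset.mem_univ, true_and]
    constructor
    · rintro ⟨⟨⟨hx1, hx2, -, -⟩, ⟨hy1, hy2, -, -⟩⟩, hxW, hyW⟩
      exact ⟨⟨⟨hxW, hx1⟩, fun h => hx2 (h ▸ Submodule.zero_mem _)⟩,
        ⟨⟨hyW, hy1⟩, fun h => hy2 (h ▸ Submodule.zero_mem _)⟩⟩
    · rintro ⟨⟨hx, hx0⟩, ⟨hy, hy0⟩⟩
      refine ⟨⟨⟨hx.2, mem_one h3 h4 hx hx0, hWW _ hx.1 _ hx.1, ?_⟩,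
        ⟨hy.2, mem_one h6 h5 hy hy0, hWW _ hy.1 _ hy.1, ?_⟩⟩, hx.1, hy.1⟩
      · have := hWW _ hx.1 _ h2
        rwa [herm_add_right H, UP H hx.2 D.hb, add_zero] at this
      · have := hWW _ hy.1 _ h2
        rwa [herm_add_right H, PU D.ha hy.2, zero_add] at this
  have dc := Finset.sum_card_bipartiteAbove_eq_sum_card_bipartiteBelow (s := G) (t := X ×ˢ Y)
    (fun (W : Submodule F (Fin k → F)) (z : (Fin k → F) × (Fin k → F)) => z.1 ∈ W ∧ z.2 ∈ W)
  rw [Finset.sum_congr rfl habove, Finset.sum_const, smul_eq_mul] at dc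
  have dc' := congrArg (fun t : ℕ => (t : ℤ) * (q:ℤ) ^ ((s + 1).choose 2)) dc
  rw [Nat.cast_sum, Finset.sum_mul, Finset.sum_congr rfl hbelow, Finset.sum_const, nsmul_eq_mul,
    Finset.card_product] at dc'
  push_cast [Nat.cast_sub (show 1 ≤ q ^ 2 from Nat.one_le_pow _ _ (by omega))] at dc'
  rw [hX, hY] at dc'
  rw [Nat.card_eq_fintype_card, Fintype.card_subtype]
  rw [dc', sq (_ * _)]

end
end HermCode

namespace HermCode
theorem final_arith (q m r s N : ℕ) (i : ℤ) (hq2 : 2 ≤ q) (hs : r + s = m) (hdim : (r : ℤ) = i + 1)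
    (key : (N : ℤ) * ((q:ℤ) ^ 2 - 1) ^ 2 * (q:ℤ) ^ ((s + 1).choose 2) =
      ((q:ℤ) ^ (2 * r) * (((q:ℤ) ^ (s + 2) - (-1) ^ (s + 2)) * ((q:ℤ) ^ (s + 1) - (-1) ^ (s + 1)))) ^ 2 *
      ((q:ℤ) ^ (m ^ 2) * ∏ j ∈ Finset.range s, ((q:ℤ) ^ (j + 1) - (-1) ^ (j + 1)))) :
    (N : ℚ) = NN q (m + 2 - 1) i * (q:ℚ)^(4*i+4) * (muH q (((m + 2 : ℕ) : ℤ)-i-2))^2 := by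
  obtain rfl : i = (r:ℤ) - 1 := by omega
  subst hs
  have key' : (N : ℚ) * ((q:ℚ) ^ 2 - 1) ^ 2 * (q:ℚ) ^ ((s + 1).choose 2) =
      ((q:ℚ) ^ (2 * r) * (((q:ℚ) ^ (s + 2) - (-1) ^ (s + 2)) * ((q:ℚ) ^ (s + 1) - (-1) ^ (s + 1)))) ^ 2 *
      ((q:ℚ) ^ ((r + s) ^ 2) * ∏ j ∈ Finset.range s, ((q:ℚ) ^ (j + 1) - (-1) ^ (j + 1))) := by
    exact_mod_cast key
  have hq0 : (q:ℚ) ≠ 0 := by positivity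
  have hq1 : (q:ℚ) ^ 2 - 1 ≠ 0 := by
    have : (2:ℚ) ≤ q := by exact_mod_cast hq2
    nlinarith
  have e1 : (((r + s + 2 - 1 : ℕ) : ℤ) - ((r:ℤ) - 1) - 1).toNat = s + 1 := by omega
  have e2 : (((r + s + 2 - 1 : ℕ) : ℤ) - ((r:ℤ) - 1) - 2).toNat = s := by omega
  have e3 : (((r + s + 2 - 1 : ℕ) : ℤ) - 1) ^ 2 = (((r + s) ^ 2 : ℕ) : ℤ) := by
    have : ((r + s + 2 - 1 : ℕ) : ℤ) - 1 = r + s := by omega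
    rw [this]; push_cast; rfl
  have e4 : ((r + s + 2 : ℕ) : ℤ) - ((r:ℤ) - 1) - 2 = ((s + 1 : ℕ) : ℤ) := by omega
  have e5 : 4 * ((r:ℤ) - 1) + 4 = ((4 * r : ℕ) : ℤ) := by push_cast; ring
  have e6 : ((s + 1 : ℕ) : ℤ) + 1 = ((s + 2 : ℕ) : ℤ) := by push_cast; ring
  rw [NN, muH, e1, e2, e3, e4, e5, e6, zpow_sub₀ hq0]
  simp only [zpow_natCast]
  field_simp
  linear_combination key'
end HermCode

namespace HermCode
/-- Number of generators through a point `P ∈ ⟨π, π^σ⟩` not on any line of `H`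
meeting `π \\ πᵢ` and `π^σ \\ πᵢ`, meeting each of `π \\ πᵢ` and `π^σ \\ πᵢ`
in exactly one point. -/
theorem stmt10 (n q p hh : ℕ) (hn : 2 ≤ n) (hp : p.Prime) (hh1 : 1 ≤ hh)
    (hq : q = p ^ hh)
    (F : Type) [Field F] [Fintype F] (hF : Fintype.card F = q ^ 2)
    (i : ℤ) (hi1 : -1 ≤ i) (hi2 : i ≤ (n:ℤ) - 3)
    (π : Submodule F (Fin (2*n+2) → F)) (hπ : Module.finrank F π = n + 1)
    (hdim : (Module.finrank F ↥(π ⊓ polar q π) : ℤ) = i + 1)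
    (P : Submodule F (Fin (2*n+2) → F)) (hP : IsHermPoint q P)
    (hPπ : ¬ P ≤ π) (hPσ : ¬ P ≤ polar q π)
    (hPspan : P ≤ π ⊔ polar q π)
    (hline : ¬ OnGoodLine q π P) :
    (Nat.card {μ : Submodule F (Fin (2*n+2) → F) //
        IsGenerator q n μ ∧ P ≤ μ ∧
        (∃! R : Submodule F (Fin (2*n+2) → F),
          Module.finrank F R = 1 ∧ R ≤ μ ⊓ π ∧ ¬ R ≤ π ⊓ polar q π) ∧
        (∃! R : Submodule F (Fin (2*n+2) → F),
          Module.finrank F R = 1 ∧ R ≤ μ ⊓ polar q π ∧ ¬ R ≤ π ⊓ polar q π)} : ℚ)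
      = NN q (n-1) i * (q:ℚ)^(4*i+4) * (muH q ((n:ℤ)-i-2))^2 := by
  classical
  have H := FC.mk' hp hh1 hq F hF
  have hq2 := H.two
  obtain ⟨m, rfl⟩ : ∃ m, n = m + 2 := ⟨n - 2, by omega⟩
  obtain ⟨hP1, hP2⟩ := hP
  set r := Module.finrank F ↥(π ⊓ polar q π) with hr
  obtain ⟨s, hs⟩ : ∃ s, r + s = m := ⟨m - r, by omega⟩
  -- a spanning vector of P
  obtain ⟨v, hv0, hvP⟩ : ∃ v, v ≠ 0 ∧ Submodule.span F {v} = P := by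
    have hne : P ≠ ⊥ := by rintro rfl; simp at hP1
    obtain ⟨v, hv, hv0⟩ := (Submodule.ne_bot_iff _).1 hne
    exact ⟨v, hv0, Submodule.eq_of_le_of_finrank_eq
      ((Submodule.span_singleton_le_iff_mem _ _).2 hv) (by rw [hP1, finrank_span_singleton hv0])⟩
  subst hvP
  rw [Submodule.span_singleton_le_iff_mem] at hPπ hPσ hPspan
  have hvv : herm q v v = 0 := hP2 v (Submodule.mem_span_singleton_self v)
  obtain ⟨a, ha, b, hb, rfl⟩ := Submodule.mem_sup.1 hPspan
  have hab := UP H ha hb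
  have hba := PU ha hb
  have hsum : herm q a a + herm q b b = 0 := by
    simpa [herm_add_left, herm_add_right H, hab, hba] using hvv
  have haσ : a ∉ polar q π := fun h => hPσ (Submodule.add_mem _ h hb)
  have hbπ : b ∉ π := fun h => hPπ (Submodule.add_mem _ ha h)
  have haa : herm q a a ≠ 0 := by
    intro haa
    have hbb : herm q b b = 0 := by simpa [haa] using hsum
    apply hline
    refine ⟨Submodule.span F {a}, Submodule.span F {b},
      finrank_span_singleton (fun h => haσ (h ▸ Submodule.zero_mem _)),
      (Submodule.span_singleton_le_iff_mem _ _).2 ha,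
      fun h => haσ ((Submodule.span_singleton_le_iff_mem _ _).1 h).2,
      finrank_span_singleton (fun h => hbπ (h ▸ Submodule.zero_mem _)),
      (Submodule.span_singleton_le_iff_mem _ _).2 hb,
      fun h => hbπ ((Submodule.span_singleton_le_iff_mem _ _).1 h).1, ?_, ?_⟩
    · rw [Submodule.span_singleton_le_iff_mem]
      exact Submodule.add_mem_sup (Submodule.mem_span_singleton_self a) (Submodule.mem_span_singleton_self b)
    · intro z hz
      obtain ⟨x, hx, y, hy, rfl⟩ := Submodule.mem_sup.1 hz
      obtain ⟨α, rfl⟩ := Submodule.mem_span_singleton.1 hx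
      obtain ⟨β, rfl⟩ := Submodule.mem_span_singleton.1 hy
      simp [herm_add_left, herm_add_right H, herm_smul_left, herm_smul_right H, hab, hba, haa, hbb]
  have hbb : herm q b b ≠ 0 := by
    intro hbb; rw [hbb, add_zero] at hsum; exact haa hsum
  have D : Dat q F (2 * (m + 2) + 2) π a b := ⟨ha, hb, haa, hbb, hvv⟩
  have key := good_count H D m s (by ring) hπ r rfl hs
  have hcard : Nat.card {μ : Submodule F (Fin (2*(m+2)+2) → F) //
        IsGenerator q (m+2) μ ∧ Submodule.span F {a + b} ≤ μ ∧
        (∃! R : Submodule F (Fin (2*(m+2)+2) → F),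
          Module.finrank F R = 1 ∧ R ≤ μ ⊓ π ∧ ¬ R ≤ π ⊓ polar q π) ∧
        (∃! R : Submodule F (Fin (2*(m+2)+2) → F),
          Module.finrank F R = 1 ∧ R ≤ μ ⊓ polar q π ∧ ¬ R ≤ π ⊓ polar q π)} =
      Nat.card {W : Submodule F (Fin (2*(m+2)+2) → F) // Lag q ⊤ W ∧ a + b ∈ W ∧
        (Module.finrank F ↥(W ⊓ π) = 1 ∧ ¬ W ⊓ π ≤ polar q π) ∧ ¬ W ⊓ polar q π ≤ π} := by
    apply Nat.card_congr
    apply Equiv.subtypeEquivRight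
    intro W
    rw [exU_iff, exU_iff, gen_iff H, Submodule.span_singleton_le_iff_mem]
    have e1 : W ⊓ π ≤ π ⊓ polar q π ↔ W ⊓ π ≤ polar q π :=
      ⟨fun h => h.trans inf_le_right, fun h => le_inf inf_le_right h⟩
    have e2 : W ⊓ polar q π ≤ π ⊓ polar q π ↔ W ⊓ polar q π ≤ π :=
      ⟨fun h => h.trans inf_le_left, fun h => le_inf h inf_le_right⟩
    rw [e1, e2]
    constructor
    · rintro ⟨h1, h2, h3, h4, h5⟩; exact ⟨h1, h2, h3, h5⟩
    · rintro ⟨h1, h2, h3, h5⟩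
      exact ⟨h1, h2, h3, by rw [lag_dims H (m + 2) rfl W π h1 hπ, h3.1], h5⟩
  rw [hcard]
  generalize Nat.card {W : Submodule F (Fin (2*(m+2)+2) → F) // Lag q ⊤ W ∧ a + b ∈ W ∧
        (Module.finrank F ↥(W ⊓ π) = 1 ∧ ¬ W ⊓ π ≤ polar q π) ∧ ¬ W ⊓ polar q π ≤ π} = N at key
  exact final_arith q m r s N i hq2 hs hdim key

end HermCode
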